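/- arXiv:2604.26992 — 2 statements merged into one kernel-verified Lean document; each statement's English description precedes it below -/
import Mathlib

section
/- Fix δ ∈ (0,1) and εmax ∈ (0,1/2). There exist constants L > 0, M > 0 and an integer N₀ ≥ 1, all depending only on δ and εmax, such that for every n ≥ N₀ there exist Borel measurable estimators θ̃ : ℝⁿ → ℝ and τ̃ : ℝⁿ → ℝ (a variance estimate) with the following property: for every θ ∈ ℝ, every σ > 0, and every probability measure Q on ℝ, P_{θ,σ,εmax,Q}^{⊗n}( { x : |θ̃(x) − θ| ≤ M·σ/√(log(e·n)) and |τ̃(x) − σ²| / σ² ≤ L/log(e·n) } ) ≥ 1 − δ/2. -/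
open MeasureTheory ProbabilityTheory Real
open scoped ENNReal NNReal

/-- Gaussian measure on `ℝ` with mean `m` and variance `v`. -/
noncomputable def gauss (m v : ℝ) : Measure ℝ := gaussianReal m (Real.toNNReal v)

/-- Efron's Gaussian two-groups model:
`(1-ε)·N(θ,σ²) + ε·(Q ∗ N(0,σ²))`. -/
noncomputable def efron (θ σ ε : ℝ) (Q : Measure ℝ) : Measure ℝ :=
  (ENNReal.ofReal (1 - ε)) • gauss θ (σ ^ 2) +
    (ENNReal.ofReal ε) • (Measure.conv Q (gauss 0 (σ ^ 2)))

/-- The `n`-fold product (i.i.d.) measure on `ℝⁿ`. -/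
noncomputable def iid (n : ℕ) (P : Measure ℝ) : Measure (Fin n → ℝ) :=
  Measure.pi fun _ => P

/-- Chebyshev's inequality for the empirical mean of a function bounded by one. -/
lemma iid_meas_le_abs_empirical_sub_integral_le {n : ℕ} (hn : 0 < n) {P : Measure ℝ}
    [IsProbabilityMeasure P] {f : ℝ → ℝ} (hf : Measurable f) (hf1 : ∀ y, |f y| ≤ 1) {h : ℝ}
    (hh : 0 < h) :
    iid n P {x | h ≤ |(n : ℝ)⁻¹ * ∑ j, f (x j) - ∫ y, f y ∂P|} ≤
      ENNReal.ofReal (1 / (n * h ^ 2)) := by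
  have hn' : (0 : ℝ) < n := by exact_mod_cast hn
  have hL : MemLp f 2 P :=
    memLp_of_bounded (a := -1) (b := 1) (ae_of_all _ fun y => abs_le.1 (hf1 y))
      hf.aestronglyMeasurable 2
  have hLi : ∀ j : Fin n, MemLp (fun x : Fin n → ℝ => f (x j)) 2 (Measure.pi fun _ => P) :=
    fun j => hL.comp_measurePreserving (measurePreserving_eval (fun _ : Fin n => P) j)
  have hLs : MemLp (∑ j : Fin n, fun x : Fin n → ℝ => f (x j)) 2 (Measure.pi fun _ => P) :=
    memLp_finsetSum' _ fun j _ => hLi j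
  have hvar : Var[∑ j : Fin n, fun x : Fin n → ℝ => f (x j); Measure.pi fun _ => P] ≤ n := by
    rw [variance_sum_pi (X := fun _ => f) fun _ => hL]
    have h1 : Var[f; P] ≤ 1 := by
      have := variance_le_sq_of_bounded (μ := P) (a := -1) (b := 1) (X := f)
        (ae_of_all _ fun y => abs_le.1 (hf1 y)) hf.aemeasurable
      norm_num at this
      exact this
    simpa using mul_le_mul_of_nonneg_left h1 hn'.le
  have hmean : ∫ x, (∑ j : Fin n, fun x : Fin n → ℝ => f (x j)) x ∂(Measure.pi fun _ => P)
      = n * ∫ y, f y ∂P := by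
    simp only [Finset.sum_apply]
    rw [integral_finsetSum _ fun j _ => (hLi j).integrable one_le_two]
    have : ∀ j : Fin n, ∫ x : Fin n → ℝ, f (x j) ∂(Measure.pi fun _ => P) = ∫ y, f y ∂P :=
      fun j => integral_comp_eval (μ := fun _ : Fin n => P) hf.aestronglyMeasurable
    simp [this]
  have hch := meas_ge_le_variance_div_sq hLs (mul_pos hn' hh)
  rw [hmean] at hch
  refine (measure_mono ?_).trans (hch.trans (ENNReal.ofReal_le_ofReal ?_))
  · intro x hx
    simp only [Set.mem_ofPred_eq, Finset.sum_apply] at hx ⊢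
    have : ∑ j, f (x j) - n * ∫ y, f y ∂P
        = n * ((n : ℝ)⁻¹ * ∑ j, f (x j) - ∫ y, f y ∂P) := by field_simp
    rw [this, abs_mul, abs_of_pos hn']
    exact mul_le_mul_of_nonneg_left hx hn'.le
  · rw [div_le_div_iff₀ (by positivity) (by positivity)]
    have := mul_le_mul_of_nonneg_right hvar (by positivity : 0 ≤ (n : ℝ) * h ^ 2)
    nlinarith

instance (m v : ℝ) : IsProbabilityMeasure (gauss m v) := by
  unfold gauss; infer_instance

lemma efron_isProbabilityMeasure {ε : ℝ} (h0 : 0 ≤ ε) (h1 : ε ≤ 1) (θ σ : ℝ) (Q : Measure ℝ)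
    [IsProbabilityMeasure Q] : IsProbabilityMeasure (efron θ σ ε Q) := by
  constructor
  simp only [efron, Measure.add_apply, Measure.smul_apply, measure_univ, smul_eq_mul, mul_one]
  rw [← ENNReal.ofReal_add (by linarith) h0]
  simp

lemma gauss_closedBall_le (m y L : ℝ) {σ : ℝ} (hσ : 0 < σ) :
    gauss m (σ ^ 2) (Metric.closedBall y L) ≤ ENNReal.ofReal (L / σ) := by
  have hv : (σ ^ 2).toNNReal ≠ 0 := by
    simp only [ne_eq, Real.toNNReal_eq_zero, not_le]; positivity
  have hpdf : ∀ z, gaussianPDF m (σ ^ 2).toNNReal z ≤ ENNReal.ofReal (1 / (2 * σ)) := by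
    intro z
    refine ENNReal.ofReal_le_ofReal ?_
    rw [gaussianPDFReal_def]
    have h1 : rexp (-(z - m) ^ 2 / (2 * ((σ ^ 2).toNNReal : ℝ))) ≤ 1 := by
      rw [Real.exp_le_one_iff]
      apply div_nonpos_of_nonpos_of_nonneg
      · nlinarith [sq_nonneg (z - m)]
      · positivity
    have h2 : 2 * σ ≤ √(2 * π * ((σ ^ 2).toNNReal : ℝ)) := by
      rw [Real.coe_toNNReal _ (by positivity)]
      apply Real.le_sqrt_of_sq_le
      nlinarith [Real.pi_gt_three, sq_nonneg σ]
    have h3 : (√(2 * π * ((σ ^ 2).toNNReal : ℝ)))⁻¹ ≤ 1 / (2 * σ) := by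
      rw [one_div]
      exact inv_anti₀ (by positivity) h2
    simpa using mul_le_mul h3 h1 (Real.exp_nonneg _) (by positivity)
  rw [gauss, gaussianReal_apply _ hv]
  calc _ ≤ ∫⁻ _ in Metric.closedBall y L, ENNReal.ofReal (1 / (2 * σ)) := lintegral_mono hpdf
    _ = ENNReal.ofReal (L / σ) := by
      rw [setLIntegral_const, Real.volume_closedBall, ← ENNReal.ofReal_mul (by positivity)]
      congr 1; field_simp

lemma efron_closedBall_le {ε : ℝ} (h0 : 0 ≤ ε) (h1 : ε ≤ 1) (θ : ℝ) (y L : ℝ) {σ : ℝ}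
    (hσ : 0 < σ) (Q : Measure ℝ) [IsProbabilityMeasure Q] :
    efron θ σ ε Q (Metric.closedBall y L) ≤ ENNReal.ofReal (L / σ) := by
  have hconv : (Measure.conv Q (gauss 0 (σ ^ 2))) (Metric.closedBall y L) ≤
      ENNReal.ofReal (L / σ) := by
    rw [← lintegral_indicator_one measurableSet_closedBall, Measure.lintegral_conv
      (measurable_one.indicator measurableSet_closedBall)]
    calc _ ≤ ∫⁻ _, ENNReal.ofReal (L / σ) ∂Q := by
          refine lintegral_mono fun q => ?_
          refine le_trans (le_of_eq ?_) (gauss_closedBall_le 0 (y - q) L hσ)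
          rw [← lintegral_indicator_one measurableSet_closedBall]
          congr 1
          ext z
          have : q + z ∈ Metric.closedBall y L ↔ z ∈ Metric.closedBall (y - q) L := by
            simp only [Metric.mem_closedBall, Real.dist_eq]
            rw [show q + z - y = z - (y - q) by ring]
          by_cases hz : z ∈ Metric.closedBall (y - q) L
          · simp [Set.indicator_of_mem, hz, this.2 hz]
          · rw [Set.indicator_of_notMem hz, Set.indicator_of_notMem (mt this.1 hz)]
      _ = _ := by simp
  simp only [efron, Measure.add_apply, Measure.smul_apply, smul_eq_mul]
  calc _ ≤ ENNReal.ofReal (1 - ε) * ENNReal.ofReal (L / σ) +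
        ENNReal.ofReal ε * ENNReal.ofReal (L / σ) := by
        gcongr
        exact gauss_closedBall_le θ y L hσ
    _ = _ := by
        rw [← add_mul, ← ENNReal.ofReal_add (by linarith) h0]
        simp

/-- The number of ordered pairs of distinct observations at distance at most `w`. -/
noncomputable def closePairs {n : ℕ} (x : Fin n → ℝ) (w : ℝ) : ℕ :=
  {p : Fin n × Fin n | p.1 ≠ p.2 ∧ |x p.1 - x p.2| ≤ w}.ncard

lemma measure_pi_pair_le {n : ℕ} {P : Measure ℝ} [IsProbabilityMeasure P] {w : ℝ} {b : ℝ≥0∞}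
    (hP : ∀ y, P (Metric.closedBall y w) ≤ b) {i j : Fin n} (hij : i ≠ j) :
    iid n P {x | |x i - x j| ≤ w} ≤ b := by
  have hind : IndepFun (fun x : Fin n → ℝ => x i) (fun x => x j) (Measure.pi fun _ => P) :=
    (iIndepFun_pi (μ := fun _ : Fin n => P) (X := fun _ => id)
      fun _ => aemeasurable_id).indepFun hij
  have hmap := (indepFun_iff_map_prod_eq_prod_map_map
    (measurable_pi_apply i).aemeasurable (measurable_pi_apply j).aemeasurable).1 hind
  have hi : ∀ i : Fin n, (Measure.pi fun _ : Fin n => P).map (fun x => x i) = P := fun i =>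
    (measurePreserving_eval (fun _ : Fin n => P) i).map_eq
  rw [hi, hi] at hmap
  have hS : MeasurableSet {q : ℝ × ℝ | |q.1 - q.2| ≤ w} :=
    measurableSet_le (by fun_prop) (by fun_prop)
  have : iid n P {x | |x i - x j| ≤ w} = (P.prod P) {q : ℝ × ℝ | |q.1 - q.2| ≤ w} := by
    rw [← hmap, Measure.map_apply (by fun_prop) hS]; rfl
  rw [this, Measure.prod_apply hS]
  calc _ ≤ ∫⁻ _, b ∂P := lintegral_mono fun y => by
        refine le_trans (measure_mono ?_) (hP y)
        intro z hz
        simpa [Real.dist_eq, abs_sub_comm] using hz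
    _ = b := by simp

lemma iid_closePairs_le {n : ℕ} (hn : 0 < n) {P : Measure ℝ} [IsProbabilityMeasure P] {w b : ℝ}
    (hP : ∀ y, P (Metric.closedBall y w) ≤ ENNReal.ofReal b) :
    iid n P {x | (n : ℝ) ^ 2 / 8 ≤ closePairs x w} ≤ ENNReal.ofReal (8 * b) := by
  classical
  set f : (Fin n → ℝ) → ℝ≥0∞ := fun x => ∑ p : Fin n × Fin n,
    if p.1 ≠ p.2 then {x : Fin n → ℝ | |x p.1 - x p.2| ≤ w}.indicator 1 x else 0 with hf
  have hSm : ∀ p : Fin n × Fin n, MeasurableSet {x : Fin n → ℝ | |x p.1 - x p.2| ≤ w} :=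
    fun p => measurableSet_le (by fun_prop) (by fun_prop)
  have hgm : ∀ p : Fin n × Fin n, Measurable fun x : Fin n → ℝ =>
      if p.1 ≠ p.2 then {x : Fin n → ℝ | |x p.1 - x p.2| ≤ w}.indicator (1 : (Fin n → ℝ) → ℝ≥0∞) x else 0 := by
    intro p
    split_ifs
    · exact measurable_one.indicator (hSm p)
    · exact measurable_const
  have hfm : Measurable f := Finset.measurable_sum _ fun p _ => hgm p
  have hfe : ∀ x, f x = (closePairs x w : ℝ≥0∞) := by
    intro x
    have : closePairs x w = ∑ p : Fin n × Fin n,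
        if p.1 ≠ p.2 ∧ |x p.1 - x p.2| ≤ w then 1 else 0 := by
      rw [closePairs, Set.ncard_eq_toFinset_card', Set.toFinset_ofPred, Finset.card_filter]
    rw [this, hf]
    push_cast
    refine Finset.sum_congr rfl fun p _ => ?_
    by_cases h1 : p.1 = p.2 <;> by_cases h2 : |x p.1 - x p.2| ≤ w <;> simp [h1, h2, Set.indicator]
  have hint : ∫⁻ x, f x ∂(iid n P) ≤ ENNReal.ofReal (n ^ 2 * b) := by
    rw [hf, lintegral_finsetSum _ fun p _ => hgm p]
    calc _ ≤ ∑ p : Fin n × Fin n, ENNReal.ofReal b := by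
          refine Finset.sum_le_sum fun p _ => ?_
          split_ifs with h
          · rw [lintegral_indicator_one (hSm p)]
            exact measure_pi_pair_le hP h
          · simp
      _ = _ := by
          rw [Finset.sum_const, Finset.card_univ, Fintype.card_prod, Fintype.card_fin,
            nsmul_eq_mul, ENNReal.ofReal_mul (by positivity), ← Nat.cast_pow,
            ENNReal.ofReal_natCast, sq]
  have hn' : (0 : ℝ) < n := by exact_mod_cast hn
  have hset : {x : Fin n → ℝ | (n : ℝ) ^ 2 / 8 ≤ closePairs x w} ⊆
      {x | ENNReal.ofReal ((n : ℝ) ^ 2 / 8) ≤ f x} := by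
    intro x hx
    simp only [Set.mem_ofPred_eq] at hx ⊢
    rw [hfe, ← ENNReal.ofReal_natCast]
    exact ENNReal.ofReal_le_ofReal hx
  calc _ ≤ _ := measure_mono hset
    _ ≤ (∫⁻ x, f x ∂(iid n P)) / ENNReal.ofReal ((n : ℝ) ^ 2 / 8) :=
        meas_ge_le_lintegral_div hfm.aemeasurable (by simp; positivity) ENNReal.ofReal_ne_top
    _ ≤ ENNReal.ofReal (n ^ 2 * b) / ENNReal.ofReal ((n : ℝ) ^ 2 / 8) := by gcongr
    _ = _ := by
        rw [← ENNReal.ofReal_div_of_pos (by positivity)]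
        congr 1; field_simp

/-- The number of observations at distance less than `w` from `a`. -/
noncomputable def ballCount {n : ℕ} (x : Fin n → ℝ) (a w : ℝ) : ℕ :=
  {j : Fin n | |x j - a| < w}.ncard

lemma gauss_abs_sub_ge_le (θ : ℝ) (σ : ℝ) {w : ℝ} (hw : 0 < w) :
    (gauss θ (σ ^ 2)).real {y | w ≤ |y - θ|} ≤ σ ^ 2 / w ^ 2 := by
  have h := meas_ge_le_variance_div_sq (μ := gauss θ (σ ^ 2)) (X := id)
    (memLp_id_gaussianReal' 2 (by simp)) hw
  simp only [gauss, id_eq, integral_id_gaussianReal, variance_id_gaussianReal,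
    Real.coe_toNNReal _ (sq_nonneg σ)] at h
  exact ENNReal.toReal_le_of_le_ofReal (by positivity) h

lemma le_efron_real_abs_sub_lt {ε : ℝ} (h0 : 0 ≤ ε) (h1 : ε ≤ 1) (θ σ : ℝ) {w : ℝ} (hw : 0 < w)
    (Q : Measure ℝ) [IsProbabilityMeasure Q] :
    (1 - ε) * (1 - σ ^ 2 / w ^ 2) ≤ (efron θ σ ε Q).real {y | |y - θ| < w} := by
  have := efron_isProbabilityMeasure h0 h1 θ σ Q
  have hS : MeasurableSet {y : ℝ | w ≤ |y - θ|} := measurableSet_le (by fun_prop) (by fun_prop)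
  have hcompl : {y : ℝ | |y - θ| < w} = {y : ℝ | w ≤ |y - θ|}ᶜ := by
    ext y; simp
  have hg : 1 - σ ^ 2 / w ^ 2 ≤ (gauss θ (σ ^ 2)).real {y | |y - θ| < w} := by
    rw [hcompl, probReal_compl_eq_one_sub hS]
    linarith [gauss_abs_sub_ge_le θ σ hw]
  calc _ ≤ (1 - ε) * (gauss θ (σ ^ 2)).real {y | |y - θ| < w} :=
        mul_le_mul_of_nonneg_left hg (by linarith)
    _ = (ENNReal.ofReal (1 - ε) * gauss θ (σ ^ 2) {y | |y - θ| < w}).toReal := by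
        rw [ENNReal.toReal_mul, ENNReal.toReal_ofReal (by linarith)]; rfl
    _ ≤ _ := by
        refine ENNReal.toReal_mono (measure_ne_top _ _) ?_
        simp only [efron, Measure.add_apply, Measure.smul_apply, smul_eq_mul]
        exact le_self_add

lemma iid_ballCount_le {n : ℕ} (hn : 0 < n) {P : Measure ℝ} [IsProbabilityMeasure P] {a w γ : ℝ}
    (hγ : 0 < γ) (hP : 1 / 2 + γ ≤ P.real {y | |y - a| < w}) :
    iid n P {x | (ballCount x a w : ℝ) ≤ n / 2} ≤ ENNReal.ofReal (1 / (n * γ ^ 2)) := by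
  classical
  have hn' : (0 : ℝ) < n := by exact_mod_cast hn
  have hS : MeasurableSet {y : ℝ | |y - a| < w} := measurableSet_lt (by fun_prop) (by fun_prop)
  refine (measure_mono ?_).trans (iid_meas_le_abs_empirical_sub_integral_le hn (P := P)
    (f := {y : ℝ | |y - a| < w}.indicator 1) (measurable_one.indicator hS) ?_ hγ)
  · intro x hx
    simp only [Set.mem_ofPred_eq] at hx ⊢
    have hsum : ∑ j, ({y : ℝ | |y - a| < w}.indicator 1 (x j) : ℝ) = ballCount x a w := by
      rw [ballCount, Set.ncard_eq_toFinset_card', Set.toFinset_ofPred, Finset.card_filter]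
      push_cast
      exact Finset.sum_congr rfl fun j _ => by simp [Set.indicator]
    rw [hsum, integral_indicator_one hS]
    have : (n : ℝ)⁻¹ * ballCount x a w ≤ 1 / 2 := by
      calc _ ≤ (n : ℝ)⁻¹ * (n / 2) := by gcongr
        _ = 1 / 2 := by field_simp
    rw [abs_sub_comm]
    exact le_trans (by linarith) (le_abs_self _)
  · intro y
    by_cases hy : |y - a| < w <;> simp [Set.indicator, hy]

/-- The empirical characteristic function at `t`, rescaled by the inverse of the characteristic
function of the Gaussian measure with mean `a` and standard deviation `s`. -/
noncomputable def scaledEmpCharFun {n : ℕ} (x : Fin n → ℝ) (a s t : ℝ) : ℂ :=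
  (n : ℂ)⁻¹ * (∑ j, Complex.exp (t * x j * Complex.I)) *
    Complex.exp (-(t * a * Complex.I) + s ^ 2 * t ^ 2 / 2)

lemma charFun_efron {ε : ℝ} (h0 : 0 ≤ ε) (h1 : ε ≤ 1) (θ σ t : ℝ) (Q : Measure ℝ)
    [IsProbabilityMeasure Q] :
    charFun (efron θ σ ε Q) t = Complex.exp (t * θ * Complex.I - σ ^ 2 * t ^ 2 / 2) *
      ((1 - ε : ℝ) + (ε : ℝ) * (Complex.exp (-(t * θ * Complex.I)) * charFun Q t)) := by
  have hint : ∀ μ : Measure ℝ, IsProbabilityMeasure μ →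
      Integrable (fun y : ℝ => Complex.exp (t * y * Complex.I)) μ := fun μ _ =>
    Integrable.of_bound (by fun_prop) 1 (ae_of_all _ fun y => by
      rw [← Complex.ofReal_mul, Complex.norm_exp_ofReal_mul_I])
  have hadd : charFun (efron θ σ ε Q) t = (1 - ε : ℝ) * charFun (gauss θ (σ ^ 2)) t +
      (ε : ℝ) * charFun (Measure.conv Q (gauss 0 (σ ^ 2))) t := by
    simp only [charFun_apply_real]
    rw [efron, integral_add_measure ((hint _ inferInstance).smul_measure ENNReal.ofReal_ne_top)
      ((hint _ inferInstance).smul_measure ENNReal.ofReal_ne_top), integral_smul_measure,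
      integral_smul_measure, ENNReal.toReal_ofReal (by linarith), ENNReal.toReal_ofReal h0]
    simp
  rw [hadd, charFun_conv, gauss, gauss, charFun_gaussianReal, charFun_gaussianReal,
    Real.coe_toNNReal _ (sq_nonneg σ)]
  push_cast
  rw [mul_add, mul_left_comm (Complex.exp (_ - _)) (ε : ℂ), ← mul_assoc (Complex.exp (_ - _))
    (Complex.exp _), ← Complex.exp_add, mul_comm (charFun Q t)]
  simp only [mul_zero, zero_mul, zero_sub]
  rw [show (t : ℂ) * θ * Complex.I - σ ^ 2 * t ^ 2 / 2 + -(t * θ * Complex.I) =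
    -(σ ^ 2 * t ^ 2 / 2) by ring]
  ring

lemma integral_cos_sin_efron {ε : ℝ} (h0 : 0 ≤ ε) (h1 : ε ≤ 1) (θ σ t : ℝ) (Q : Measure ℝ)
    [IsProbabilityMeasure Q] :
    ‖(rexp (σ ^ 2 * t ^ 2 / 2) : ℂ) * ((∫ y, cos (t * (y - θ)) ∂(efron θ σ ε Q) : ℝ) +
      (∫ y, sin (t * (y - θ)) ∂(efron θ σ ε Q) : ℝ) * Complex.I) - (1 - ε : ℝ)‖ ≤ ε := by
  have := efron_isProbabilityMeasure h0 h1 θ σ Q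
  set P := efron θ σ ε Q with hPdef
  have hc : Integrable (fun y : ℝ => cos (t * (y - θ))) P :=
    Integrable.of_bound (by fun_prop) 1 (ae_of_all _ fun y => abs_cos_le_one _)
  have hs : Integrable (fun y : ℝ => sin (t * (y - θ))) P :=
    Integrable.of_bound (by fun_prop) 1 (ae_of_all _ fun y => abs_sin_le_one _)
  have hcs : ((∫ y, cos (t * (y - θ)) ∂P : ℝ) : ℂ) + (∫ y, sin (t * (y - θ)) ∂P : ℝ) * Complex.I
      = Complex.exp (-(t * θ * Complex.I)) * charFun P t := by
    rw [charFun_apply_real, ← integral_const_mul, ← integral_complex_ofReal,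
      ← integral_complex_ofReal, ← integral_mul_const, ← integral_add hc.ofReal
      (hs.ofReal.mul_const _)]
    refine integral_congr_ae (ae_of_all _ fun y => ?_)
    simp only [Complex.ofReal_cos, Complex.ofReal_sin]
    rw [← Complex.exp_mul_I, ← Complex.exp_add]
    congr 1
    push_cast
    ring
  rw [hcs, charFun_efron h0 h1, ← mul_assoc (Complex.exp _) (Complex.exp _), ← Complex.exp_add,
    ← mul_assoc, Complex.ofReal_exp, ← Complex.exp_add]
  have hz : ((σ ^ 2 * t ^ 2 / 2 : ℝ) : ℂ) + (-(t * θ * Complex.I) + (t * θ * Complex.I -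
      σ ^ 2 * t ^ 2 / 2)) = 0 := by push_cast; ring
  rw [hz, Complex.exp_zero, one_mul, add_sub_cancel_left, norm_mul, norm_mul, Complex.norm_real,
    Real.norm_of_nonneg h0]
  have : ‖Complex.exp (-(t * θ * Complex.I))‖ = 1 := by
    rw [← neg_mul, ← Complex.ofReal_mul, ← Complex.ofReal_neg, Complex.norm_exp_ofReal_mul_I]
  rw [this, one_mul]
  exact mul_le_of_le_one_right h0 (norm_charFun_le_one t)

lemma iid_scaledEmpCharFun_le {n : ℕ} (hn : 0 < n) {ε : ℝ} (h0 : 0 ≤ ε) (h1 : ε < 1 / 2)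
    (θ σ t : ℝ) (Q : Measure ℝ) [IsProbabilityMeasure Q] :
    iid n (efron θ σ ε Q) {x | 1 / 2 ≤ ‖scaledEmpCharFun x θ σ t - (1 - ε : ℝ)‖} ≤
      ENNReal.ofReal (8 * rexp (σ ^ 2 * t ^ 2) / (n * (1 / 2 - ε) ^ 2)) := by
  have := efron_isProbabilityMeasure h0 (by linarith) θ σ Q
  have hn' : (0 : ℝ) < n := by exact_mod_cast hn
  have hbound := integral_cos_sin_efron h0 (by linarith) θ σ t Q
  set P := efron θ σ ε Q with hPdef
  set E := rexp (σ ^ 2 * t ^ 2 / 2) with hE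
  have hE0 : 0 < E := Real.exp_pos _
  have hE2 : rexp (σ ^ 2 * t ^ 2) = E ^ 2 := by rw [hE, ← Real.exp_nat_mul]; congr 1; push_cast; ring
  set α := ∫ y, cos (t * (y - θ)) ∂P
  set β := ∫ y, sin (t * (y - θ)) ∂P
  have hh : 0 < (1 / 2 - ε) / (2 * E) := div_pos (by linarith) (by positivity)
  have hA := iid_meas_le_abs_empirical_sub_integral_le hn (P := P)
    (f := fun y => cos (t * (y - θ))) (by fun_prop) (fun y => abs_cos_le_one _) hh
  have hB := iid_meas_le_abs_empirical_sub_integral_le hn (P := P)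
    (f := fun y => sin (t * (y - θ))) (by fun_prop) (fun y => abs_sin_le_one _) hh
  refine (measure_mono ?_).trans ((measure_union_le _ _).trans
    ((add_le_add hA hB).trans (le_of_eq ?_)))
  · intro x hx
    simp only [Set.mem_ofPred_eq, Set.mem_union] at hx ⊢
    by_contra! hcon
    set A := (n : ℝ)⁻¹ * ∑ j, cos (t * (x j - θ)) with hAdef
    set B := (n : ℝ)⁻¹ * ∑ j, sin (t * (x j - θ)) with hBdef
    have hstat : scaledEmpCharFun x θ σ t = (E : ℂ) * (A + B * Complex.I) := by
      rw [hAdef, hBdef, scaledEmpCharFun, Complex.exp_add, hE]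
      push_cast
      rw [mul_assoc _ (∑ j, Complex.sin _) Complex.I, ← mul_add, Finset.sum_mul,
        ← Finset.sum_add_distrib]
      simp_rw [← Complex.exp_mul_I]
      rw [mul_assoc, ← mul_assoc (∑ j, _), Finset.sum_mul]
      simp_rw [← Complex.exp_add]
      simp_rw [mul_sub, sub_mul, ← sub_eq_add_neg]
      ring
    have hsplit : scaledEmpCharFun x θ σ t - (1 - ε : ℝ) =
        (E : ℂ) * (((A - α : ℝ) : ℂ) + ((B - β : ℝ) : ℂ) * Complex.I) +
        ((E : ℂ) * ((α : ℂ) + β * Complex.I) - (1 - ε : ℝ)) := by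
      rw [hstat]; push_cast; ring
    have h2 : ‖(E : ℂ) * (((A - α : ℝ) : ℂ) + ((B - β : ℝ) : ℂ) * Complex.I)‖ ≤
        E * (|A - α| + |B - β|) := by
      rw [norm_mul, Complex.norm_real, Real.norm_of_nonneg hE0.le]
      gcongr
      refine (norm_add_le _ _).trans ?_
      simp only [norm_mul, Complex.norm_real, Complex.norm_I, mul_one, Real.norm_eq_abs, le_refl]
    have h3 : E * (|A - α| + |B - β|) < 1 / 2 - ε := by
      calc _ < E * ((1 / 2 - ε) / (2 * E) + (1 / 2 - ε) / (2 * E)) := by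
            gcongr; exacts [hcon.1, hcon.2]
        _ = _ := by field_simp; ring
    rw [hsplit] at hx
    have := norm_add_le ((E : ℂ) * (((A - α : ℝ) : ℂ) + ((B - β : ℝ) : ℂ) * Complex.I))
      ((E : ℂ) * ((α : ℂ) + β * Complex.I) - (1 - ε : ℝ))
    linarith
  · rw [← ENNReal.ofReal_add (by positivity) (by positivity), hE2]
    congr 1
    have : (1 / 2 - ε) ≠ 0 := by linarith
    field_simp
    ring

lemma closePairs_mono {n : ℕ} (x : Fin n → ℝ) {w w' : ℝ} (h : w ≤ w') :
    closePairs x w ≤ closePairs x w' :=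
  Set.ncard_le_ncard (fun _ hp => ⟨hp.1, hp.2.trans h⟩) (Set.toFinite _)

lemma sq_div_eight_le_closePairs {n : ℕ} (hn : 2 ≤ n) {x : Fin n → ℝ} {a w : ℝ}
    (h : (n : ℝ) / 2 < ballCount x a w) : (n : ℝ) ^ 2 / 8 ≤ closePairs x (2 * w) := by
  classical
  set S : Finset (Fin n) := {j | |x j - a| < w} with hS
  have hcard : ballCount x a w = S.card := by
    rw [ballCount, Set.ncard_eq_toFinset_card', Set.toFinset_ofPred]
  have hle : S.offDiag.card ≤ closePairs x (2 * w) := by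
    rw [closePairs, Set.ncard_eq_toFinset_card']
    refine Finset.card_le_card fun p hp => ?_
    rw [Finset.mem_offDiag] at hp
    obtain ⟨h1, h2, h3⟩ := hp
    simp only [hS, Finset.mem_filter, Finset.mem_univ, true_and] at h1 h2
    simp only [Set.mem_toFinset, Set.mem_ofPred_eq]
    refine ⟨h3, ?_⟩
    rw [abs_lt] at h1 h2
    rw [abs_le]
    constructor <;> linarith
  rw [Finset.offDiag_card] at hle
  rw [hcard] at h
  have h1 : n + 1 ≤ 2 * S.card := by
    have : (n : ℝ) < 2 * S.card := by linarith
    exact_mod_cast this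
  have h2 : (S.card : ℝ) * S.card - S.card ≤ closePairs x (2 * w) := by
    have : S.card * S.card ≤ closePairs x (2 * w) + S.card := by omega
    have : (S.card : ℝ) * S.card ≤ closePairs x (2 * w) + S.card := by exact_mod_cast this
    linarith
  have h3 : (n : ℝ) + 1 ≤ 2 * S.card := by exact_mod_cast h1
  have h4 : (2 : ℝ) ≤ n := by exact_mod_cast hn
  nlinarith

lemma abs_sub_lt_of_ballCount {n : ℕ} {x : Fin n → ℝ} {a w a' w' : ℝ}
    (h : (n : ℝ) / 2 < ballCount x a w) (h' : (n : ℝ) / 2 < ballCount x a' w') :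
    |a - a'| < w + w' := by
  have hne : ({j : Fin n | |x j - a| < w} ∩ {j | |x j - a'| < w'}).Nonempty := by
    by_contra hcon
    have hd : Disjoint {j : Fin n | |x j - a| < w} {j | |x j - a'| < w'} :=
      Set.disjoint_iff_inter_eq_empty.2 (Set.not_nonempty_iff_eq_empty.1 hcon)
    have h1 := Set.ncard_union_eq hd
    have h2 := Set.ncard_le_card ({j : Fin n | |x j - a| < w} ∪ {j | |x j - a'| < w'})
    rw [h1, Nat.card_fin] at h2
    have h3 : (ballCount x a w : ℝ) + ballCount x a' w' ≤ n := by exact_mod_cast h2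
    linarith
  obtain ⟨j, hj, hj'⟩ := hne
  simp only [Set.mem_ofPred_eq, abs_lt] at hj hj' ⊢
  constructor <;> linarith [hj.1, hj.2, hj'.1, hj'.2]

lemma bounds_of_norm_mul_exp_sub_lt {z : ℂ} {a s t p : ℝ} (hp0 : 0 ≤ p) (hp1 : p ≤ 1)
    (h : ‖z * Complex.exp (-(t * a * Complex.I) + s ^ 2 * t ^ 2 / 2) - p‖ < 1 / 2) :
    p - 1 / 2 < ‖z‖ * rexp (s ^ 2 * t ^ 2 / 2) ∧ ‖z‖ * rexp (s ^ 2 * t ^ 2 / 2) < 3 / 2 ∧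
      p - 1 / 2 < (z * Complex.exp (-(t * a * Complex.I))).re * rexp (s ^ 2 * t ^ 2 / 2) := by
  set u := z * Complex.exp (-(t * a * Complex.I)) with hu
  have huz : ‖u‖ = ‖z‖ := by
    rw [hu, norm_mul, ← neg_mul, ← Complex.ofReal_mul, ← Complex.ofReal_neg,
      Complex.norm_exp_ofReal_mul_I, mul_one]
  set E := rexp (s ^ 2 * t ^ 2 / 2) with hE
  have hE0 : 0 < E := Real.exp_pos _
  have hw : z * Complex.exp (-(t * a * Complex.I) + s ^ 2 * t ^ 2 / 2) = u * (E : ℂ) := by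
    rw [Complex.exp_add, hu, hE]; push_cast; ring
  rw [hw] at h
  have hre : p - 1 / 2 < u.re * E := by
    have h1 := (abs_le.1 (Complex.abs_re_le_norm (u * (E : ℂ) - p))).1
    simp only [Complex.sub_re, Complex.mul_re, Complex.ofReal_re, Complex.ofReal_im, mul_zero,
      sub_zero] at h1
    linarith
  refine ⟨?_, ?_, hre⟩
  · rw [← huz]
    exact hre.trans_le (mul_le_mul_of_nonneg_right (Complex.re_le_norm u) hE0.le)
  · have hn : ‖u * (E : ℂ)‖ = ‖z‖ * E := by
      rw [norm_mul, huz, Complex.norm_real, Real.norm_of_nonneg hE0.le]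
    rw [← hn, show u * (E : ℂ) = (u * (E : ℂ) - p) + p by ring]
    refine (norm_add_le _ _).trans_lt ?_
    rw [Complex.norm_real, Real.norm_of_nonneg hp0]; linarith

lemma separation_of_norm_mul_exp_sub_lt {z : ℂ} {a s a' s' t p : ℝ} (hp : 1 / 2 < p) (hp1 : p ≤ 1)
    (h : ‖z * Complex.exp (-(t * a * Complex.I) + s ^ 2 * t ^ 2 / 2) - p‖ < 1 / 2)
    (h' : ‖z * Complex.exp (-(t * a' * Complex.I) + s' ^ 2 * t ^ 2 / 2) - p‖ < 1 / 2) :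
    |s ^ 2 - s' ^ 2| * t ^ 2 / 2 ≤ log (3 / 2 / (p - 1 / 2)) ∧
      (p - 1 / 2) / (3 / 2) < |cos ((a - a') * t / 2)| := by
  obtain ⟨l1, u1, r1⟩ := bounds_of_norm_mul_exp_sub_lt (by linarith) hp1 h
  obtain ⟨l2, u2, r2⟩ := bounds_of_norm_mul_exp_sub_lt (by linarith) hp1 h'
  have hh : 0 < p - 1 / 2 := by linarith
  have hz : 0 < ‖z‖ := by
    by_contra hcon
    have : ‖z‖ = 0 := le_antisymm (not_lt.1 hcon) (norm_nonneg z)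
    rw [this] at l1; linarith
  constructor
  · have key : ∀ b b' : ℝ, p - 1 / 2 < ‖z‖ * rexp b → ‖z‖ * rexp b' < 3 / 2 →
        b' - b ≤ log (3 / 2 / (p - 1 / 2)) := by
      intro b b' hb hb'
      rw [Real.le_log_iff_exp_le (by positivity), Real.exp_sub,
        div_le_div_iff₀ (Real.exp_pos _) hh]
      have e1 := Real.exp_pos b
      have e2 := Real.exp_pos b'
      nlinarith
    have k1 := key _ _ l1 u2
    have k2 := key _ _ l2 u1
    rw [mul_div_assoc]
    rcases abs_cases (s ^ 2 - s' ^ 2) with ⟨he, _⟩ | ⟨he, _⟩ <;> rw [he] <;> linarith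
  · have hre : ∀ b E : ℝ, 0 < E → ‖z‖ * E < 3 / 2 → p - 1 / 2 < b * E →
        (p - 1 / 2) / (3 / 2) * ‖z‖ < b := by
      intro b E hE hu hr
      have : (p - 1 / 2) / (3 / 2) * ‖z‖ * E < b * E := by
        refine lt_of_le_of_lt ?_ hr
        have := mul_le_mul_of_nonneg_left hu.le (by positivity : 0 ≤ (p - 1 / 2) / (3 / 2))
        nlinarith
      exact lt_of_mul_lt_mul_right this hE.le
    have m1 := hre _ _ (Real.exp_pos _) u1 r1
    have m2 := hre _ _ (Real.exp_pos _) u2 r2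
    have hsum : z * Complex.exp (-(t * a * Complex.I)) + z * Complex.exp (-(t * a' * Complex.I)) =
        z * Complex.exp (((-(t * (a + a') / 2) : ℝ) : ℂ) * Complex.I) *
          ((2 * cos ((a - a') * t / 2) : ℝ) : ℂ) := by
      push_cast
      rw [Complex.two_cos, mul_add, mul_assoc z (Complex.exp _), mul_assoc z (Complex.exp _),
        ← Complex.exp_add, ← Complex.exp_add, add_comm]
      congr 3 <;> ring
    have hle := Complex.re_le_norm (z * Complex.exp (-(t * a * Complex.I)) +
      z * Complex.exp (-(t * a' * Complex.I)))
    rw [Complex.add_re] at hle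
    rw [hsum, norm_mul, norm_mul, Complex.norm_exp_ofReal_mul_I, Complex.norm_real,
      Real.norm_eq_abs, abs_mul, abs_two, mul_one] at hle
    have : (p - 1 / 2) / (3 / 2) * (2 * ‖z‖) < |cos ((a - a') * t / 2)| * (2 * ‖z‖) := by linarith
    exact lt_of_mul_lt_mul_right this (by positivity)

/-- If `|d|` is small at the coarsest scale and `|cos|` stays above `cos y₀` along a geometric
progression of ratio `π / (2 y₀)`, then no wrapping around occurs up to the finest scale. -/
lemma abs_mul_zpow_le_of_cos_lt {y₀ r d : ℝ} (hy0 : 0 < y₀)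
    (hr : r = π / (2 * y₀)) {i₀ i₁ : ℤ} (hi : i₀ ≤ i₁) (h0 : |d * r ^ i₀ / 2| ≤ y₀)
    (hcos : ∀ i, i₀ ≤ i → i ≤ i₁ → cos y₀ < |cos (d * r ^ i / 2)|) :
    |d * r ^ i₁ / 2| ≤ y₀ := by
  have hr0 : 0 < r := hr ▸ div_pos Real.pi_pos (by linarith)
  induction i₁, hi using Int.leInduction with
  | base => exact h0
  | succ i hi ih =>
    have h1 := ih fun j hj hj' => hcos j hj (by omega)
    have h2 := hcos (i + 1) (by omega) le_rfl
    have h3 : d * r ^ (i + 1) / 2 = r * (d * r ^ i / 2) := by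
      rw [zpow_add_one₀ hr0.ne']; ring
    have h4 : |d * r ^ (i + 1) / 2| ≤ π / 2 := by
      rw [h3, abs_mul, abs_of_pos hr0]
      calc _ ≤ r * y₀ := by gcongr
        _ = π / 2 := by rw [hr]; field_simp
    by_contra! hcon
    rw [← Real.cos_abs (d * r ^ (i + 1) / 2), abs_of_nonneg (Real.cos_nonneg_of_neg_pi_div_two_le_of_le
      (by linarith [abs_nonneg (d * r ^ (i + 1) / 2)]) h4)] at h2
    exact absurd h2 (not_lt.2 (Real.cos_le_cos_of_nonneg_of_le_pi hy0.le
      (by linarith [Real.pi_pos]) hcon.le))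

/-- The parameters `(k, a, s)` are compatible with the sample `x`: `r ^ (-k)` is a plausible scale,
`a` is within a multiple of the scale from the bulk of the sample, and the Gaussian characteristic
function with parameters `(a, s)` matches the empirical one on a geometric range of frequencies. -/
structure Compatible {n : ℕ} (p r K c : ℝ) (m N : ℕ) (x : Fin n → ℝ) (k : ℤ) (a s : ℝ) :
    Prop where
  ball : (n : ℝ) / 2 < ballCount x a (K * r ^ (-k))
  pairs : closePairs x (c * r ^ (-k)) < (n : ℝ) ^ 2 / 8
  charFun : ∀ i ∈ Finset.Icc (k - m) (k + N), ‖scaledEmpCharFun x a s (r ^ i) - p‖ < 1 / 2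

lemma Compatible.separation_of_le {n : ℕ} (hn : 2 ≤ n) {p y₀ r K c : ℝ} {D m N : ℕ}
    {x : Fin n → ℝ} (hp : 1 / 2 < p) (hp1 : p ≤ 1) (hy0 : 0 < y₀) (hy1 : y₀ < π / 2)
    (hcos : cos y₀ = (p - 1 / 2) / (3 / 2)) (hr : r = π / (2 * y₀)) (hK : 0 < K) (hc : 0 < c)
    (hD : 2 * K / c ≤ r ^ D) (hDm : D ≤ m) (hm : K * r ^ D / y₀ ≤ r ^ m) {k k' : ℤ}
    (hk : k ≤ k') {a s a' s' : ℝ} (h : Compatible p r K c m N x k a s)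
    (h' : Compatible p r K c m N x k' a' s') :
    k' - k ≤ D ∧ |s ^ 2 - s' ^ 2| * (r ^ (k + N)) ^ 2 / 2 ≤ log (3 / 2 / (p - 1 / 2)) ∧
      |a - a'| * r ^ (k + N) / 2 ≤ y₀ := by
  have hr1 : 1 < r := by rw [hr, lt_div_iff₀ (by linarith)]; linarith
  have hr0 : 0 < r := by linarith
  have hkD : k' - k ≤ D := by
    by_contra! hcon
    have h1 := (sq_div_eight_le_closePairs hn h'.ball)
    have h2 : 2 * (K * r ^ (-k')) ≤ c * r ^ (-k) := by
      have h3 : 2 * K / c ≤ r ^ (k' - k) := by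
        refine hD.trans ?_
        rw [← zpow_natCast]
        exact zpow_le_zpow_right₀ hr1.le hcon.le
      rw [div_le_iff₀ hc] at h3
      have h4 : r ^ (-k) = r ^ (k' - k) * r ^ (-k') := by
        rw [← zpow_add₀ hr0.ne']; congr 1; ring
      rw [h4]
      have h5 : 0 < r ^ (-k') := zpow_pos hr0 _
      nlinarith
    have h3 : (closePairs x (2 * (K * r ^ (-k'))) : ℝ) ≤ closePairs x (c * r ^ (-k)) := by
      exact_mod_cast closePairs_mono x h2
    linarith [h.pairs]
  have hsep : ∀ i, k' - m ≤ i → i ≤ k + N →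
      |s ^ 2 - s' ^ 2| * (r ^ i) ^ 2 / 2 ≤ log (3 / 2 / (p - 1 / 2)) ∧
      (p - 1 / 2) / (3 / 2) < |cos ((a - a') * r ^ i / 2)| := by
    intro i h1 h2
    exact separation_of_norm_mul_exp_sub_lt hp hp1
      (h.charFun i (Finset.mem_Icc.2 ⟨by omega, by omega⟩))
      (h'.charFun i (Finset.mem_Icc.2 ⟨by omega, by omega⟩))
  have hi : k' - m ≤ k + N := by omega
  refine ⟨hkD, (hsep _ hi le_rfl).1, ?_⟩
  have hfin := abs_mul_zpow_le_of_cos_lt (d := a - a') hy0 hr hi ?_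
    fun i h1 h2 => hcos ▸ (hsep i h1 h2).2
  · rwa [abs_div, abs_mul, abs_of_pos (zpow_pos hr0 _), abs_two] at hfin
  · rw [abs_div, abs_mul, abs_of_pos (zpow_pos hr0 _), abs_two]
    have h1 := abs_sub_lt_of_ballCount h.ball h'.ball
    have h2 : r ^ (-k') ≤ r ^ (-k) := zpow_le_zpow_right₀ hr1.le (by omega)
    have h3 : |a - a'| ≤ 2 * K * r ^ (-k) := by nlinarith
    have h4 : r ^ (-k) * r ^ (k' - m) ≤ r ^ D * (r ^ m)⁻¹ := by
      rw [← zpow_add₀ hr0.ne', ← zpow_natCast, ← zpow_natCast, ← zpow_neg, ← zpow_add₀ hr0.ne']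
      exact zpow_le_zpow_right₀ hr1.le (by omega)
    calc |a - a'| * r ^ (k' - m) / 2 ≤ 2 * K * r ^ (-k) * r ^ (k' - m) / 2 := by gcongr
      _ = K * (r ^ (-k) * r ^ (k' - m)) := by ring
      _ ≤ K * (r ^ D * (r ^ m)⁻¹) := by gcongr
      _ ≤ y₀ := by
        rw [div_le_iff₀ hy0] at hm
        rw [← mul_assoc, ← div_eq_mul_inv, div_le_iff₀ (by positivity)]
        linarith

lemma Compatible.separation {n : ℕ} (hn : 2 ≤ n) {p y₀ r K c : ℝ} {D m N : ℕ}
    {x : Fin n → ℝ} (hp : 1 / 2 < p) (hp1 : p ≤ 1) (hy0 : 0 < y₀) (hy1 : y₀ < π / 2)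
    (hcos : cos y₀ = (p - 1 / 2) / (3 / 2)) (hr : r = π / (2 * y₀)) (hK : 0 < K) (hc : 0 < c)
    (hD : 2 * K / c ≤ r ^ D) (hDm : D ≤ m) (hm : K * r ^ D / y₀ ≤ r ^ m) {k k' : ℤ}
    {a s a' s' : ℝ} (h : Compatible p r K c m N x k a s)
    (h' : Compatible p r K c m N x k' a' s') :
    |s ^ 2 - s' ^ 2| * (r ^ (k' - D + N)) ^ 2 / 2 ≤ log (3 / 2 / (p - 1 / 2)) ∧
      |a - a'| * r ^ (k' - D + N) / 2 ≤ y₀ := by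
  have hr1 : 1 < r := by rw [hr, lt_div_iff₀ (by linarith)]; linarith
  have hr0 : 0 < r := by linarith
  obtain ⟨l, hl, h1, h2⟩ : ∃ l : ℤ, k' - D ≤ l ∧
      |s ^ 2 - s' ^ 2| * (r ^ (l + N)) ^ 2 / 2 ≤ log (3 / 2 / (p - 1 / 2)) ∧
      |a - a'| * r ^ (l + N) / 2 ≤ y₀ := by
    rcases le_total k k' with hk | hk
    · obtain ⟨h1, h2⟩ := h.separation_of_le hn hp hp1 hy0 hy1 hcos hr hK hc hD hDm hm hk h'
      exact ⟨k, by omega, h2⟩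
    · obtain ⟨h1, h2⟩ := h'.separation_of_le hn hp hp1 hy0 hy1 hcos hr hK hc hD hDm hm hk h
      rw [abs_sub_comm (s' ^ 2), abs_sub_comm a'] at h2
      exact ⟨k', by omega, h2⟩
  have hle : r ^ (k' - D + N) ≤ r ^ (l + N) := zpow_le_zpow_right₀ hr1.le (by omega)
  have hpos : 0 < r ^ (k' - D + N) := zpow_pos hr0 _
  constructor
  · refine le_trans ?_ h1; gcongr
  · refine le_trans ?_ h2; gcongr

lemma ballCount_eq_sum {n : ℕ} (x : Fin n → ℝ) (a w : ℝ) :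
    ballCount x a w = ∑ j, if |x j - a| < w then 1 else 0 := by
  classical
  rw [ballCount, Set.ncard_eq_toFinset_card', Set.toFinset_ofPred, Finset.card_filter]

lemma closePairs_eq_sum {n : ℕ} (x : Fin n → ℝ) (w : ℝ) :
    closePairs x w = ∑ p : Fin n × Fin n,
      if p.1 ≠ p.2 ∧ |x p.1 - x p.2| ≤ w then 1 else 0 := by
  classical
  rw [closePairs, Set.ncard_eq_toFinset_card', Set.toFinset_ofPred, Finset.card_filter]

lemma measurable_ballCount {n : ℕ} (a w : ℝ) :
    Measurable fun x : Fin n → ℝ => (ballCount x a w : ℝ) := by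
  simp_rw [ballCount_eq_sum]
  push_cast
  exact Finset.measurable_sum _ fun j _ => Measurable.ite
    (measurableSet_lt (by fun_prop) (by fun_prop)) measurable_const measurable_const

lemma measurable_closePairs {n : ℕ} (w : ℝ) :
    Measurable fun x : Fin n → ℝ => (closePairs x w : ℝ) := by
  simp_rw [closePairs_eq_sum]
  push_cast
  refine Finset.measurable_sum _ fun p _ => Measurable.ite ?_ measurable_const measurable_const
  have : MeasurableSet {x : Fin n → ℝ | |x p.1 - x p.2| ≤ w} :=
    measurableSet_le (by fun_prop) (by fun_prop)
  exact (MeasurableSet.const (p.1 ≠ p.2)).inter this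

lemma measurableSet_compatible {n : ℕ} (p r K c : ℝ) (m N : ℕ) (k : ℤ) (a s : ℝ) :
    MeasurableSet {x : Fin n → ℝ | Compatible p r K c m N x k a s} := by
  have heq : {x : Fin n → ℝ | Compatible p r K c m N x k a s} =
      {x | (n : ℝ) / 2 < ballCount x a (K * r ^ (-k))} ∩
      {x | (closePairs x (c * r ^ (-k)) : ℝ) < (n : ℝ) ^ 2 / 8} ∩
      ⋂ i ∈ Finset.Icc (k - m) (k + N), {x | ‖scaledEmpCharFun x a s (r ^ i) - p‖ < 1 / 2} := by
    ext x
    simp only [Set.mem_inter_iff, Set.mem_iInter, Set.mem_ofPred_eq]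
    exact ⟨fun h => ⟨⟨h.ball, h.pairs⟩, h.charFun⟩, fun h => ⟨h.1.1, h.1.2, h.2⟩⟩
  rw [heq]
  refine ((measurableSet_lt measurable_const (measurable_ballCount _ _)).inter
    (measurableSet_lt (measurable_closePairs _) measurable_const)).inter
    (Finset.measurableSet_biInter _ fun i _ => measurableSet_lt ?_ measurable_const)
  unfold scaledEmpCharFun
  fun_prop

lemma Compatible.exists_rat {n : ℕ} {p r K c : ℝ} {m N : ℕ} {x : Fin n → ℝ} {k : ℤ} {θ σ : ℝ}
    (h : Compatible p r K c m N x k θ σ) :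
    ∃ a s : ℚ, Compatible p r K c m N x k a s := by
  have hball : ∀ᶠ q : ℝ × ℝ in nhds (θ, σ), ∀ j : Fin n,
      |x j - θ| < K * r ^ (-k) → |x j - q.1| < K * r ^ (-k) := by
    rw [Filter.eventually_all]
    intro j
    by_cases hj : |x j - θ| < K * r ^ (-k)
    · have hc : ContinuousAt (fun q : ℝ × ℝ => |x j - q.1|) (θ, σ) := by fun_prop
      exact (hc.eventually_lt continuousAt_const hj).mono fun q hq _ => hq
    · exact Filter.Eventually.of_forall fun q hq => absurd hq hj
  have hchar : ∀ᶠ q : ℝ × ℝ in nhds (θ, σ), ∀ i ∈ Finset.Icc (k - m) (k + N),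
      ‖scaledEmpCharFun x q.1 q.2 (r ^ i) - p‖ < 1 / 2 := by
    rw [Filter.eventually_all_finset]
    intro i hi
    have hc : ContinuousAt (fun q : ℝ × ℝ => ‖scaledEmpCharFun x q.1 q.2 (r ^ i) - p‖) (θ, σ) := by
      unfold scaledEmpCharFun
      fun_prop
    exact hc.eventually_lt continuousAt_const (h.charFun i hi)
  obtain ⟨⟨a, s⟩, hq1, hq2⟩ := (Rat.denseRange_cast (𝕜 := ℝ)).prodMap
    (Rat.denseRange_cast (𝕜 := ℝ)) |>.mem_nhds (hball.and hchar)
  refine ⟨a, s, h.ball.trans_le ?_, h.pairs, hq2⟩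
  exact_mod_cast Set.ncard_le_ncard (fun j hj => hq1 j hj) (Set.toFinite _)

lemma exists_measurable_selection {X ι : Type*} [MeasurableSpace X] [Countable ι] [Nonempty ι]
    (T : ι → Set X) (hT : ∀ i, MeasurableSet (T i)) :
    ∃ f : X → ι, (∀ g : ι → ℝ, Measurable fun x => g (f x)) ∧
      ∀ x, (∃ i, x ∈ T i) → x ∈ T (f x) := by
  classical
  obtain ⟨e, he⟩ := exists_surjective_nat ι
  have hex : ∀ x, ∃ l, x ∈ T (e l) ∨ ∀ l, x ∉ T (e l) := by
    intro x
    by_cases h : ∃ l, x ∈ T (e l)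
    · exact h.imp fun l hl => Or.inl hl
    · exact ⟨0, Or.inr (not_exists.1 h)⟩
  have hm : Measurable fun x => Nat.find (hex x) := by
    refine measurable_find hex fun l => ?_
    have : {x | x ∈ T (e l) ∨ ∀ l, x ∉ T (e l)} = T (e l) ∪ ⋂ l, (T (e l))ᶜ := by
      ext x; simp
    rw [this]
    exact (hT _).union (MeasurableSet.iInter fun l => (hT _).compl)
  refine ⟨fun x => e (Nat.find (hex x)), fun g => (measurable_from_nat (f := g ∘ e)).comp hm, ?_⟩
  rintro x ⟨i, hi⟩
  obtain ⟨l, rfl⟩ := he i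
  exact (Nat.find_spec (hex x)).resolve_right fun h => h l hi

lemma iid_not_compatible_le {n : ℕ} (hn : 0 < n) {ε : ℝ} (h0 : 0 ≤ ε) (h1 : ε < 1 / 2)
    {r c : ℝ} (hr : 1 < r) (hc : 0 < c) (m N : ℕ) (θ : ℝ) {σ : ℝ} (hσ : 0 < σ) {k : ℤ}
    (hk : σ * r ^ k ≤ 1) (hk' : 1 < σ * r ^ (k + 1)) (Q : Measure ℝ) [IsProbabilityMeasure Q] :
    iid n (efron θ σ ε Q)
      {x | ¬ Compatible (1 - ε) r (2 / (1 / 2 - ε)) c m N x k θ σ} ≤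
      ENNReal.ofReal (4 / (n * (1 / 2 - ε) ^ 2) + 8 * (c * r) +
        (N + m + 1) * (8 * rexp ((r ^ N) ^ 2) / (n * (1 / 2 - ε) ^ 2))) := by
  have := efron_isProbabilityMeasure h0 (by linarith) θ σ Q
  have hr0 : 0 < r := by linarith
  have hn' : (0 : ℝ) < n := by exact_mod_cast hn
  set h := 1 / 2 - ε with hh
  have hh0 : 0 < h := by linarith
  have hu : 0 < r ^ (-k) := zpow_pos hr0 _
  have hσu : σ ≤ r ^ (-k) := by
    rwa [zpow_neg, ← one_div, le_div_iff₀ (zpow_pos hr0 _)]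
  have hA := iid_ballCount_le hn (P := efron θ σ ε Q) (a := θ) (w := 2 / h * r ^ (-k))
    (γ := h / 2) (by positivity) (by
      refine le_trans ?_ (le_efron_real_abs_sub_lt h0 (by linarith) θ σ (by positivity) Q)
      have h2 : σ ^ 2 / (2 / h * r ^ (-k)) ^ 2 ≤ h ^ 2 / 4 := by
        have h3 : σ ^ 2 ≤ (r ^ (-k)) ^ 2 := by gcongr
        calc _ ≤ (r ^ (-k)) ^ 2 / (2 / h * r ^ (-k)) ^ 2 := by gcongr
          _ = h ^ 2 / 4 := by field_simp; norm_num
      have h4 : (1 - ε) * (1 - h ^ 2 / 4) ≤ (1 - ε) * (1 - σ ^ 2 / (2 / h * r ^ (-k)) ^ 2) :=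
        mul_le_mul_of_nonneg_left (by linarith) (by linarith)
      refine le_trans ?_ h4
      nlinarith)
  have hB := iid_closePairs_le hn (P := efron θ σ ε Q) (w := c * r ^ (-k)) (b := c * r) (by
    intro y
    refine (efron_closedBall_le h0 (by linarith) θ y _ hσ Q).trans (ENNReal.ofReal_le_ofReal ?_)
    rw [div_le_iff₀ hσ, mul_assoc]
    refine mul_le_mul_of_nonneg_left ?_ hc.le
    rw [zpow_neg, ← one_div, div_le_iff₀ (zpow_pos hr0 _)]
    rw [zpow_add_one₀ hr0.ne'] at hk'
    nlinarith)
  have hC : ∀ i ∈ Finset.Icc (k - m) (k + N), iid n (efron θ σ ε Q)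
      {x | 1 / 2 ≤ ‖scaledEmpCharFun x θ σ (r ^ i) - (1 - ε : ℝ)‖} ≤
      ENNReal.ofReal (8 * rexp ((r ^ N) ^ 2) / (n * h ^ 2)) := by
    intro i hi
    refine (iid_scaledEmpCharFun_le hn h0 h1 θ σ (r ^ i) Q).trans (ENNReal.ofReal_le_ofReal ?_)
    have hle : σ * r ^ i ≤ r ^ N := by
      calc σ * r ^ i ≤ σ * r ^ (k + N) := by
            gcongr
            exacts [hr.le, (Finset.mem_Icc.1 hi).2]
        _ = (σ * r ^ k) * r ^ N := by rw [zpow_add₀ hr0.ne', zpow_natCast]; ring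
        _ ≤ 1 * r ^ N := by gcongr
        _ = r ^ N := one_mul _
    rw [← mul_pow]
    have : 0 ≤ σ * r ^ i := by positivity
    gcongr
  have hCsum : iid n (efron θ σ ε Q) (⋃ i ∈ Finset.Icc (k - m) (k + N),
      {x | 1 / 2 ≤ ‖scaledEmpCharFun x θ σ (r ^ i) - (1 - ε : ℝ)‖}) ≤
      ENNReal.ofReal ((N + m + 1) * (8 * rexp ((r ^ N) ^ 2) / (n * h ^ 2))) := by
    refine (measure_biUnion_finset_le _ _).trans ((Finset.sum_le_sum hC).trans (le_of_eq ?_))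
    have hcard : (Finset.Icc (k - m) (k + N)).card = N + m + 1 := by
      rw [Int.card_Icc]; omega
    rw [Finset.sum_const, hcard, nsmul_eq_mul, ENNReal.ofReal_mul (by positivity)]
    congr 1
    rw [← ENNReal.ofReal_natCast]
    push_cast
    rfl
  have hsub : {x : Fin n → ℝ | ¬ Compatible (1 - ε) r (2 / h) c m N x k θ σ} ⊆
      ({x | (ballCount x θ (2 / h * r ^ (-k)) : ℝ) ≤ n / 2} ∪
        {x | (n : ℝ) ^ 2 / 8 ≤ closePairs x (c * r ^ (-k))}) ∪
      ⋃ i ∈ Finset.Icc (k - m) (k + N),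
        {x | 1 / 2 ≤ ‖scaledEmpCharFun x θ σ (r ^ i) - (1 - ε : ℝ)‖} := by
    intro x hx
    by_contra hcon
    simp only [Set.mem_union, Set.mem_iUnion, Set.mem_ofPred_eq, not_or, not_exists, not_le]
      at hcon
    exact hx ⟨hcon.1.1, hcon.1.2, hcon.2⟩
  calc _ ≤ _ := measure_mono hsub
    _ ≤ _ := (measure_union_le _ _).trans (add_le_add (measure_union_le _ _) le_rfl)
    _ ≤ _ := add_le_add (add_le_add hA hB) hCsum
    _ = _ := by
      rw [← ENNReal.ofReal_add (by positivity) (by positivity),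
        ← ENNReal.ofReal_add (by positivity) (by positivity)]
      congr 3
      field_simp
      norm_num

lemma eventually_error_lt {h r δ : ℝ} (m : ℕ) (hh : 0 < h) (hr : 1 < r) (hδ : 0 < δ) :
    ∀ᶠ n : ℕ in Filter.atTop, ∀ N : ℕ, r ^ N ≤ √(log n / 2) →
      4 / (n * h ^ 2) + (N + m + 1) * (8 * rexp ((r ^ N) ^ 2) / (n * h ^ 2)) < δ := by
  have hr1 : 0 < r - 1 := by linarith
  have hlog : Filter.Tendsto (fun n : ℕ => log n / (n : ℝ) ^ (1 / 2 : ℝ)) Filter.atTop (nhds 0) :=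
    (isLittleO_log_rpow_atTop (by norm_num : (0 : ℝ) < 1 / 2)).tendsto_div_nhds_zero.comp
      tendsto_natCast_atTop_atTop
  have hpow : Filter.Tendsto (fun n : ℕ => ((n : ℝ) ^ (1 / 2 : ℝ))⁻¹) Filter.atTop (nhds 0) :=
    ((tendsto_rpow_atTop (by norm_num : (0 : ℝ) < 1 / 2)).comp
      tendsto_natCast_atTop_atTop).inv_tendsto_atTop
  have hinv : Filter.Tendsto (fun n : ℕ => ((n : ℝ))⁻¹) Filter.atTop (nhds 0) :=
    tendsto_natCast_atTop_atTop.inv_tendsto_atTop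
  have hlim : Filter.Tendsto (fun n : ℕ => 4 / h ^ 2 * ((n : ℝ))⁻¹ +
      (8 / h ^ 2 / (r - 1) * (log n / (n : ℝ) ^ (1 / 2 : ℝ)) +
        8 / h ^ 2 * (m + 1) * ((n : ℝ) ^ (1 / 2 : ℝ))⁻¹)) Filter.atTop (nhds 0) := by
    simpa using (hinv.const_mul (4 / h ^ 2)).add ((hlog.const_mul (8 / h ^ 2 / (r - 1))).add
      (hpow.const_mul (8 / h ^ 2 * (m + 1))))
  have hlarge : ∀ᶠ n : ℕ in Filter.atTop, 1 ≤ log n :=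
    (tendsto_log_atTop.comp tendsto_natCast_atTop_atTop).eventually_ge_atTop 1
  filter_upwards [hlim.eventually_lt_const hδ, hlarge, Filter.eventually_gt_atTop 0]
    with n hn hl hn0 N hN
  have hn' : (0 : ℝ) < n := by exact_mod_cast hn0
  refine lt_of_le_of_lt ?_ hn
  have hsq : (r ^ N) ^ 2 ≤ log n / 2 := by
    rw [← Real.sq_sqrt (by linarith : 0 ≤ log n / 2)]
    gcongr
  have hexp : rexp ((r ^ N) ^ 2) ≤ (n : ℝ) ^ (1 / 2 : ℝ) := by
    rw [Real.rpow_def_of_pos hn']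
    apply Real.exp_le_exp.2
    linarith
  have hNle : (N : ℝ) ≤ log n / (r - 1) := by
    rw [le_div_iff₀ hr1]
    have h1 := one_add_mul_sub_le_pow (by linarith : (-1 : ℝ) ≤ r) N
    nlinarith [one_le_pow₀ hr.le (n := N)]
  have hs : (n : ℝ) = (n : ℝ) ^ (1 / 2 : ℝ) * (n : ℝ) ^ (1 / 2 : ℝ) := by
    rw [← Real.rpow_add hn']; norm_num
  have hs0 : 0 < (n : ℝ) ^ (1 / 2 : ℝ) := Real.rpow_pos_of_pos hn' _
  have hr2 : r - 1 ≠ 0 := hr1.ne'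
  refine add_le_add (le_of_eq (by field_simp)) ?_
  calc (N + m + 1) * (8 * rexp ((r ^ N) ^ 2) / (n * h ^ 2))
      ≤ (log n / (r - 1) + m + 1) * (8 * (n : ℝ) ^ (1 / 2 : ℝ) / (n * h ^ 2)) := by gcongr
    _ = (log n / (r - 1) + m + 1) * (8 / ((n : ℝ) ^ (1 / 2 : ℝ) * h ^ 2)) := by
        congr 1
        nth_rewrite 2 [hs]
        field_simp
    _ = _ := by
        field_simp
        ring

/-- Pilot estimators (Lemma 2.6): there exist a pilot mean estimator `θ̃` and a pilot
variance estimator `τ̃` with rates `M·σ/√(log(en))` and `L·σ²/log(en)` respectively,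
with probability at least `1 - δ/2`, uniformly over `θ, σ, Q`. -/
theorem pilot_estimators (δ εmax : ℝ)
    (hδ : δ ∈ Set.Ioo (0:ℝ) 1) (hεm : εmax ∈ Set.Ioo (0:ℝ) (1/2)) :
    ∃ (L M : ℝ) (N₀ : ℕ), 0 < L ∧ 0 < M ∧ 1 ≤ N₀ ∧
      ∀ n : ℕ, N₀ ≤ n →
        ∃ θt τt : (Fin n → ℝ) → ℝ, Measurable θt ∧ Measurable τt ∧
          ∀ (θ σ : ℝ), 0 < σ → ∀ Q : Measure ℝ, IsProbabilityMeasure Q →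
            ENNReal.ofReal (1 - δ/2) ≤
              iid n (efron θ σ εmax Q)
                {x | |θt x - θ| ≤ M * σ / Real.sqrt (Real.log (Real.exp 1 * n)) ∧
                     |τt x - σ ^ 2| / σ ^ 2 ≤ L / Real.log (Real.exp 1 * n)} := by
  obtain ⟨hδ0, hδ1⟩ := hδ
  obtain ⟨hε0, hε1⟩ := hεm
  set h := 1 / 2 - εmax with hh
  have hh0 : 0 < h := by linarith
  set p := 1 - εmax with hp
  have hph : p - 1 / 2 = h := by rw [hp, hh]; ring
  set y₀ := arccos (h / (3 / 2)) with hy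
  have hy0 : 0 < y₀ := Real.arccos_pos.2 (by rw [div_lt_one (by norm_num)]; linarith)
  have hy1 : y₀ < π / 2 := Real.arccos_lt_pi_div_two.2 (by positivity)
  have hcos : cos y₀ = (p - 1 / 2) / (3 / 2) := by
    rw [hph, hy, Real.cos_arccos]
    · linarith [div_pos hh0 (by norm_num : (0 : ℝ) < 3 / 2)]
    · rw [div_le_one (by norm_num)]; linarith
  obtain ⟨r, hr⟩ : ∃ r, r = π / (2 * y₀) := ⟨_, rfl⟩
  have hr1 : 1 < r := by rw [hr, lt_div_iff₀ (by linarith)]; linarith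
  have hr0 : 0 < r := by linarith
  set c := δ / (64 * r) with hc
  have hc0 : 0 < c := by positivity
  set K := 2 / h with hK
  have hK0 : 0 < K := by positivity
  obtain ⟨D, hD⟩ := pow_unbounded_of_one_lt (2 * K / c) hr1
  obtain ⟨m₀, hm₀⟩ := pow_unbounded_of_one_lt (K * r ^ D / y₀) hr1
  set m := max D m₀ with hm
  have hmm : K * r ^ D / y₀ ≤ r ^ m :=
    hm₀.le.trans (pow_le_pow_right₀ hr1.le (le_max_right _ _))
  set Λ := log (3 / 2 / h) with hΛ
  have hΛ0 : 0 < Λ := Real.log_pos (by rw [lt_div_iff₀ hh0]; linarith)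
  have hlarge : ∀ᶠ n : ℕ in Filter.atTop, 2 ≤ log n :=
    (tendsto_log_atTop.comp tendsto_natCast_atTop_atTop).eventually_ge_atTop 2
  obtain ⟨N₀, hN₀⟩ := Filter.eventually_atTop.1
    ((eventually_error_lt m hh0 hr1 (by positivity : 0 < δ / 4)).and hlarge)
  refine ⟨8 * Λ * (r ^ (D + 2)) ^ 2, 4 * y₀ * r ^ (D + 2), max N₀ 2, by positivity, by positivity,
    by omega, fun n hn => ?_⟩
  have hn2 : 2 ≤ n := (le_max_right _ _).trans hn
  obtain ⟨herr, hlog⟩ := hN₀ n ((le_max_left _ _).trans hn)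
  have hn' : (0 : ℝ) < n := by exact_mod_cast (by omega : 0 < n)
  set y := √(log n / 2) with hydef
  have hysq : y ^ 2 = log n / 2 := Real.sq_sqrt (by linarith)
  have hy1' : 1 ≤ y := Real.one_le_sqrt.2 (by linarith)
  obtain ⟨N, hN, hN'⟩ := exists_nat_pow_near hy1' hr1
  have hlen : log (rexp 1 * n) = 1 + log n := by
    rw [Real.log_mul (Real.exp_pos _).ne' hn'.ne', Real.log_exp]
  have hylen : √(log (rexp 1 * n)) ≤ 2 * y := by
    apply Real.sqrt_le_iff.2 ⟨by positivity, ?_⟩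
    rw [hlen, mul_pow, hysq]
    linarith
  have hlen0 : 0 < log (rexp 1 * n) := by rw [hlen]; linarith
  obtain ⟨f, hfm, hf⟩ := exists_measurable_selection
    (fun q : ℤ × ℚ × ℚ => {x : Fin n → ℝ | Compatible p r K c m N x q.1 q.2.1 q.2.2})
    fun q => measurableSet_compatible _ _ _ _ _ _ _ _ _
  refine ⟨fun x => (f x).2.1, fun x => ((f x).2.2 : ℝ) ^ 2, hfm fun q => (q.2.1 : ℝ),
    hfm fun q => (q.2.2 : ℝ) ^ 2, fun θ σ hσ Q hQ => ?_⟩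
  have := efron_isProbabilityMeasure hε0.le (by linarith) θ σ Q
  have : IsProbabilityMeasure (iid n (efron θ σ εmax Q)) := by unfold iid; infer_instance
  obtain ⟨k, hk, hk'⟩ := exists_mem_Ico_zpow (inv_pos.2 hσ) hr1
  have hkσ : σ * r ^ k ≤ 1 := by
    calc _ ≤ σ * σ⁻¹ := by gcongr
      _ = 1 := mul_inv_cancel₀ hσ.ne'
  have hkσ' : 1 < σ * r ^ (k + 1) := by
    calc 1 = σ * σ⁻¹ := (mul_inv_cancel₀ hσ.ne').symm
      _ < _ := by gcongr
  have hbad := iid_not_compatible_le (n := n) (by omega) hε0.le hε1 hr1 hc0 m N θ hσ hkσ hkσ' Q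
  have hbad' : iid n (efron θ σ εmax Q) {x | ¬ Compatible p r K c m N x k θ σ} ≤
      ENNReal.ofReal (δ / 2) := by
    refine hbad.trans (ENNReal.ofReal_le_ofReal ?_)
    have h1 := herr N hN
    have h2 : 8 * (c * r) = δ / 8 := by rw [hc]; field_simp; norm_num
    rw [h2]
    linarith
  have hgood : ENNReal.ofReal (1 - δ / 2) ≤
      iid n (efron θ σ εmax Q) {x | Compatible p r K c m N x k θ σ} := by
    rw [ENNReal.ofReal_sub _ (by linarith), ENNReal.ofReal_one, tsub_le_iff_right]
    calc (1 : ℝ≥0∞) = iid n (efron θ σ εmax Q) ({x | Compatible p r K c m N x k θ σ} ∪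
          {x | ¬ Compatible p r K c m N x k θ σ}) := by
          rw [← measure_univ (μ := iid n (efron θ σ εmax Q))]
          congr 1
          ext x
          simp [em]
      _ ≤ _ := (measure_union_le _ _).trans (by gcongr)
  refine hgood.trans (measure_mono fun x hx => ?_)
  obtain ⟨a, s, has⟩ := hx.exists_rat
  have hfx : Compatible p r K c m N x (f x).1 (f x).2.1 (f x).2.2 := hf x ⟨(k, a, s), has⟩
  obtain ⟨hs, ha⟩ := hfx.separation hn2 (by linarith) (by linarith) hy0 hy1 hcos hr hK0 hc0 hD.le
    (le_max_left _ _) hmm hx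
  rw [hph, ← hΛ] at hs
  set R := r ^ (k - D + N) with hR
  have hR0 : 0 < R := zpow_pos hr0 _
  have hyR : y < r ^ (D + 2) * σ * R := by
    calc y < 1 * r ^ (N + 1) := by rwa [one_mul]
      _ ≤ σ * r ^ (k + 1) * r ^ (N + 1) := by gcongr
      _ = r ^ (D + 2) * σ * R := by
        rw [hR, mul_assoc, mul_comm _ σ, mul_assoc]
        congr 1
        rw [← zpow_natCast, ← zpow_natCast, ← zpow_add₀ hr0.ne', ← zpow_add₀ hr0.ne']
        congr 1
        push_cast
        ring
  refine ⟨?_, ?_⟩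
  · rw [le_div_iff₀ (Real.sqrt_pos.2 hlen0)]
    calc _ ≤ |((f x).2.1 : ℝ) - θ| * (2 * (r ^ (D + 2) * σ * R)) := by
          gcongr; linarith
      _ = (|((f x).2.1 : ℝ) - θ| * R / 2) * (4 * r ^ (D + 2) * σ) := by ring
      _ ≤ y₀ * (4 * r ^ (D + 2) * σ) := by gcongr
      _ = _ := by ring
  · rw [div_le_div_iff₀ (by positivity) hlen0]
    have h1 : log (rexp 1 * n) ≤ 4 * (r ^ (D + 2) * σ * R) ^ 2 := by
      calc log (rexp 1 * n) ≤ 4 * y ^ 2 := by rw [hlen, hysq]; linarith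
        _ ≤ _ := by gcongr
    calc _ ≤ |((f x).2.2 : ℝ) ^ 2 - σ ^ 2| * (4 * (r ^ (D + 2) * σ * R) ^ 2) := by gcongr
      _ = (|((f x).2.2 : ℝ) ^ 2 - σ ^ 2| * R ^ 2 / 2) * (8 * (r ^ (D + 2)) ^ 2 * σ ^ 2) := by ring
      _ ≤ Λ * (8 * (r ^ (D + 2)) ^ 2 * σ ^ 2) := by gcongr
      _ = _ := by ring
end

section
/- For every εmax ∈ (0,1/2) there exists a constant c > 0 depending only on εmax such that for every ε ∈ (0, εmax], every positive integer K divisible by 4, and every τ > 0, there exist finitely supported probability measures ν₀ and ν₁ on ℝ with: (1) point concentration: ν₀({0}) ≥ 1 − εmax and ν₁({c·ε^{1/2}/τ}) ≥ 1 − ε; (2) moment matching: ∫ y^k dν₀(y) = ∫ y^k dν₁(y) for every integer k with 0 ≤ k ≤ K+1; (3) magnitude of moments: if in addition K/τ ≥ 1, then |∫ y^k dν₀(y)| ≤ 2ε·(K/τ)^k and |∫ y^k dν₁(y)| ≤ 2ε·(K/τ)^k for every integer k ≥ 2. -/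
open MeasureTheory Real

/-- A finitely supported probability measure with prescribed masses at the points `x / τ`. -/
lemma exists_discrete_measure (S : Finset ℝ) (p : ℝ → ℝ) (hp : ∀ x ∈ S, 0 ≤ p x)
    (hsum : ∑ x ∈ S, p x = 1) (τ : ℝ) :
    ∃ ν : Measure ℝ, IsProbabilityMeasure ν ∧ (∃ s : Finset ℝ, ν (s : Set ℝ) = 1) ∧
      (∀ x ∈ S, ENNReal.ofReal (p x) ≤ ν {x / τ}) ∧
      ∀ k : ℕ, ∫ y, y ^ k ∂ν = ∑ x ∈ S, p x * (x / τ) ^ k := by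
  have hone : ∑ x ∈ S, ENNReal.ofReal (p x) = 1 := by
    rw [← ENNReal.ofReal_sum_of_nonneg hp, hsum, ENNReal.ofReal_one]
  refine ⟨∑ x ∈ S, ENNReal.ofReal (p x) • Measure.dirac (x / τ), ⟨?_⟩,
    ⟨S.image (fun x => x / τ), ?_⟩, ?_, ?_⟩
  · simpa [Measure.finsetSum_apply] using hone
  · rw [Measure.finsetSum_apply, ← hone]
    refine Finset.sum_congr rfl fun x hx => ?_
    have : x / τ ∈ ((S.image (fun x => x / τ) : Finset ℝ) : Set ℝ) := by
      simpa using ⟨x, hx, rfl⟩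
    rw [Measure.smul_apply, Measure.dirac_apply_of_mem this, smul_eq_mul, mul_one]
  · intro x hx
    rw [Measure.finsetSum_apply]
    calc ENNReal.ofReal (p x)
        = (ENNReal.ofReal (p x) • Measure.dirac (x / τ)) {x / τ} := by simp
      _ ≤ _ := Finset.single_le_sum
          (f := fun y => (ENNReal.ofReal (p y) • Measure.dirac (y / τ)) {x / τ})
          (fun _ _ => zero_le) hx
  · intro k
    rw [integral_finsetSum_measure]
    · refine Finset.sum_congr rfl fun x hx => ?_
      rw [integral_smul_measure, integral_dirac, ENNReal.toReal_ofReal (hp x hx), smul_eq_mul]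
    · intro x _
      exact (integrable_dirac (by simp)).smul_measure ENNReal.ofReal_ne_top

/-- The partial products of Euler's factorization of `sin (π t) / (π t)`. -/
noncomputable def sineProd (m : ℕ) (t : ℝ) : ℝ :=
  ∏ i ∈ Finset.range m, (1 - t ^ 2 / ((i : ℝ) + 1) ^ 2)

lemma sineProd_bounds (m : ℕ) {t : ℝ} (h0 : 0 ≤ t) (h1 : t ≤ 1 / 2) :
    0 < sineProd m t ∧ sineProd m t ≤ 1 ∧ 1 - 2 * t ^ 2 ≤ sineProd m t := by
  suffices h : 0 < sineProd m t ∧ sineProd m t ≤ 1 ∧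
      1 - t ^ 2 * (2 - 2 / ((m : ℝ) + 1)) ≤ sineProd m t by
    refine ⟨h.1, h.2.1, le_trans ?_ h.2.2⟩
    have : 0 ≤ t ^ 2 * (2 / ((m : ℝ) + 1)) := by positivity
    linarith
  induction m with
  | zero => simp [sineProd]
  | succ m ih =>
    obtain ⟨hpos, hle, hge⟩ := ih
    have hrec : sineProd (m + 1) t = sineProd m t * (1 - t ^ 2 / ((m : ℝ) + 1) ^ 2) :=
      Finset.prod_range_succ _ _
    set a : ℝ := t ^ 2 / ((m : ℝ) + 1) ^ 2 with ha
    have ha0 : 0 ≤ a := by positivity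
    have ha1 : a < 1 := by
      rw [ha, div_lt_one (by positivity)]
      have : (0 : ℝ) ≤ m := by positivity
      nlinarith
    have hstep : a ≤ t ^ 2 * (2 / ((m : ℝ) + 1) - 2 / ((m : ℝ) + 1 + 1)) := by
      rw [ha, div_eq_mul_inv]
      gcongr
      rw [inv_eq_one_div, div_sub_div _ _ (by positivity) (by positivity),
        div_le_div_iff₀ (by positivity) (by positivity)]
      have : (0 : ℝ) ≤ m := by positivity
      nlinarith [mul_nonneg this this]
    rw [hrec]
    refine ⟨mul_pos hpos (by linarith), by nlinarith, ?_⟩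
    push_cast
    nlinarith

lemma prod_sub_symm_range (m : ℕ) (t : ℝ) :
    ∏ i ∈ Finset.range (2 * m + 1), (t - ((i : ℝ) - m)) =
      t * ((-1) ^ m * (m.factorial : ℝ) ^ 2 * sineProd m t) := by
  induction m with
  | zero => simp [sineProd]
  | succ m ih =>
    have hrec : sineProd (m + 1) t = sineProd m t * (1 - t ^ 2 / ((m : ℝ) + 1) ^ 2) :=
      Finset.prod_range_succ _ _
    rw [show 2 * (m + 1) + 1 = (2 * m + 1 + 1) + 1 by ring, Finset.prod_range_succ',
      Finset.prod_range_succ]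
    have : ∏ i ∈ Finset.range (2 * m + 1), (t - (((i + 1 : ℕ) : ℝ) - ((m + 1 : ℕ) : ℝ))) =
        ∏ i ∈ Finset.range (2 * m + 1), (t - ((i : ℝ) - m)) :=
      Finset.prod_congr rfl fun i _ => by push_cast; ring
    rw [this, ih, hrec, Nat.factorial_succ]
    push_cast
    field_simp
    ring

lemma prod_erase_range_sub (n d : ℕ) :
    ∏ i ∈ (Finset.range (n + d + 1)).erase n, ((n : ℝ) - i) =
      (-1) ^ d * (n.factorial * d.factorial) := by
  induction d with
  | zero =>
    have : (Finset.range (n + 0 + 1)).erase n = Finset.range n := by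
      ext i; simp; omega
    rw [this, ← Finset.prod_range_reflect, ← Finset.prod_range_add_one_eq_factorial]
    push_cast
    simp only [pow_zero, one_mul, Nat.factorial_zero, Nat.cast_one, mul_one]
    refine Finset.prod_congr rfl fun i hi => ?_
    have hi' := Finset.mem_range.1 hi
    rw [Nat.cast_sub (by omega), Nat.cast_sub (by omega)]
    push_cast
    ring
  | succ d ih =>
    have : (Finset.range (n + (d + 1) + 1)).erase n =
        insert (n + d + 1) ((Finset.range (n + d + 1)).erase n) := by
      ext i; simp; omega
    rw [this, Finset.prod_insert (by simp), ih, Nat.factorial_succ]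
    push_cast
    ring

lemma sum_inv_sq_symm_range (m : ℕ) :
    ∑ i ∈ Finset.range (2 * m + 1), (((i : ℝ) - m) ^ 2)⁻¹ ≤ 4 := by
  suffices h : ∑ i ∈ Finset.range (2 * m + 1), (((i : ℝ) - m) ^ 2)⁻¹ ≤ 4 - 4 / ((m : ℝ) + 1) by
    have : (0 : ℝ) ≤ 4 / ((m : ℝ) + 1) := by positivity
    linarith
  induction m with
  | zero => simp
  | succ m ih =>
    rw [show 2 * (m + 1) + 1 = (2 * m + 1 + 1) + 1 by ring, Finset.sum_range_succ',
      Finset.sum_range_succ]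
    have : ∑ i ∈ Finset.range (2 * m + 1), ((((i + 1 : ℕ) : ℝ) - ((m + 1 : ℕ) : ℝ)) ^ 2)⁻¹ =
        ∑ i ∈ Finset.range (2 * m + 1), (((i : ℝ) - m) ^ 2)⁻¹ :=
      Finset.sum_congr rfl fun i _ => by push_cast; ring_nf
    rw [this]
    push_cast
    have e1 : (2 * (m : ℝ) + 1 + 1 - (m + 1)) = m + 1 := by ring
    have e2 : ((0 : ℝ) - (m + 1)) ^ 2 = (m + 1) ^ 2 := by ring
    rw [e1, e2]
    have hstep : 2 * (((m : ℝ) + 1) ^ 2)⁻¹ ≤ 4 / ((m : ℝ) + 1) - 4 / ((m : ℝ) + 1 + 1) := by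
      rw [← div_eq_mul_inv, div_sub_div _ _ (by positivity) (by positivity),
        div_le_div_iff₀ (by positivity) (by positivity)]
      have : (0 : ℝ) ≤ m := by positivity
      nlinarith [mul_nonneg this this]
    linarith

lemma sq_factorial_le (m n d : ℕ) (h : n + d = 2 * m) :
    m.factorial ^ 2 ≤ n.factorial * d.factorial := by
  have h1 := Nat.choose_mul_factorial_mul_factorial (show n ≤ 2 * m by omega)
  have h2 := Nat.add_choose_mul_factorial_mul_factorial m m
  have h3 := Nat.choose_le_centralBinom n m
  rw [show 2 * m - n = d by omega] at h1
  rw [← two_mul] at h2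
  rw [Nat.centralBinom_eq_two_mul_choose] at h3
  have hpos : 0 < (2 * m).choose m := Nat.choose_pos (by omega)
  refine Nat.le_of_mul_le_mul_left ?_ hpos
  calc (2 * m).choose m * m.factorial ^ 2 = (2 * m).choose n * n.factorial * d.factorial := by
        rw [h1, ← h2]; ring
    _ ≤ (2 * m).choose m * (n.factorial * d.factorial) := by
        rw [mul_assoc]; exact Nat.mul_le_mul_right _ h3

lemma sum_pow_div_prod_eq_zero (S : Finset ℝ) (k : ℕ) (hk : k + 1 < S.card) :
    ∑ x ∈ S, x ^ k / ∏ y ∈ S.erase x, (x - y) = 0 := by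
  have h := Lagrange.coeff_eq_sum (s := S) (v := id) Function.injective_id.injOn
    (P := (Polynomial.X : Polynomial ℝ) ^ k)
    (by rw [Polynomial.degree_X_pow]; exact_mod_cast (by omega : k < S.card))
  rw [Polynomial.coeff_X_pow, if_neg (by omega)] at h
  simpa using h.symm

/-- The integers `-m, …, m` as real numbers. -/
noncomputable def symmNodes (m : ℕ) : Finset ℝ :=
  (Finset.range (2 * m + 1)).image fun i : ℕ => (i : ℝ) - m

lemma injective_cast_sub (m : ℕ) : Function.Injective fun i : ℕ => (i : ℝ) - m :=
  fun a b h => by simpa using h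

lemma prod_symmNodes (m : ℕ) (t : ℝ) :
    ∏ y ∈ symmNodes m, (t - y) = t * ((-1) ^ m * (m.factorial : ℝ) ^ 2 * sineProd m t) := by
  rw [symmNodes, Finset.prod_image (injective_cast_sub m).injOn, prod_sub_symm_range]

lemma prod_symmNodes_erase (m n d : ℕ) (h : n + d = 2 * m) :
    ∏ y ∈ (symmNodes m).erase ((n : ℝ) - m), ((n : ℝ) - m - y) =
      (-1) ^ d * (n.factorial * d.factorial) := by
  rw [symmNodes, ← Finset.image_erase (injective_cast_sub m),
    Finset.prod_image (injective_cast_sub m).injOn, ← prod_erase_range_sub n d, h]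
  exact Finset.prod_congr rfl fun i _ => by ring

lemma abs_div_prod_symmNodes_erase_le (m : ℕ) {x : ℝ} (hx : x ∈ symmNodes m) :
    |(-1) ^ m * (m.factorial : ℝ) ^ 2 / ∏ y ∈ (symmNodes m).erase x, (x - y)| ≤ 1 := by
  obtain ⟨n, hn, rfl⟩ := Finset.mem_image.1 hx
  obtain ⟨d, hd⟩ : ∃ d, n + d = 2 * m := ⟨2 * m - n, by have := Finset.mem_range.1 hn; omega⟩
  rw [prod_symmNodes_erase m n d hd, abs_div, abs_mul, abs_mul, abs_neg_one_pow, abs_neg_one_pow,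
    one_mul, one_mul, abs_of_nonneg (by positivity), abs_of_nonneg (by positivity)]
  exact div_le_one_of_le₀ (by exact_mod_cast sq_factorial_le m n d hd) (by positivity)

lemma zero_mem_symmNodes (m : ℕ) : (0 : ℝ) ∈ symmNodes m :=
  Finset.mem_image.2 ⟨m, Finset.mem_range.2 (by omega), sub_self _⟩

lemma abs_le_of_mem_symmNodes {m : ℕ} {x : ℝ} (hx : x ∈ symmNodes m) : |x| ≤ m := by
  obtain ⟨n, hn, rfl⟩ := Finset.mem_image.1 hx
  have : (n : ℝ) ≤ 2 * m := by
    exact_mod_cast (by have := Finset.mem_range.1 hn; omega : n ≤ 2 * m)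
  have h0 : (0 : ℝ) ≤ n := by positivity
  rw [abs_le]
  constructor <;> linarith

lemma one_le_abs_of_mem_symmNodes {m : ℕ} {x : ℝ} (hx : x ∈ symmNodes m) (h0 : x ≠ 0) :
    1 ≤ |x| := by
  obtain ⟨n, hn, rfl⟩ := Finset.mem_image.1 hx
  have hz : ((n : ℤ) - m) ≠ 0 := fun h => h0 (by exact_mod_cast h)
  exact_mod_cast Int.one_le_abs hz

lemma sum_inv_sq_symmNodes (m : ℕ) : ∑ x ∈ symmNodes m, (x ^ 2)⁻¹ ≤ 4 := by
  rw [symmNodes, Finset.sum_image (injective_cast_sub m).injOn]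
  exact sum_inv_sq_symm_range m

lemma abs_inv_sub_mul_inv_sub_le {x a b : ℝ} (hx : 1 ≤ |x|) (ha0 : 0 ≤ a) (ha : a ≤ 1 / 2)
    (hb0 : 0 ≤ b) (hb : b ≤ 1 / 2) : |(x - a)⁻¹ * (x - b)⁻¹| ≤ 4 * (x ^ 2)⁻¹ := by
  have hdist : ∀ t : ℝ, 0 ≤ t → t ≤ 1 / 2 → |x| / 2 ≤ |x - t| := fun t h0 h1 => by
    have := abs_sub_abs_le_abs_sub x t
    rw [abs_of_nonneg h0] at this
    linarith
  have hpos : 0 < |x| / 2 := by linarith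
  rw [abs_mul, abs_inv, abs_inv]
  calc |x - a|⁻¹ * |x - b|⁻¹ ≤ (|x| / 2)⁻¹ * (|x| / 2)⁻¹ := by
        gcongr
        · exact hdist a ha0 ha
        · exact hdist b hb0 hb
    _ = 4 * (x ^ 2)⁻¹ := by
        rw [← sq_abs x, ← mul_inv, show |x| / 2 * (|x| / 2) = |x| ^ 2 / 4 by ring, inv_div,
          div_eq_mul_inv]

set_option maxHeartbeats 800000 in
/-- A signed measure with vanishing moments whose mass is mostly at `0`, `δ` and `μ`. -/
lemma exists_annihilating_weights (m : ℕ) (hm : 0 < m) {δ μ : ℝ} (hδ : 0 < δ) (hδμ : δ < μ)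
    (hμ : μ ≤ 1 / 2) :
    ∃ (S : Finset ℝ) (w : ℝ → ℝ), {0, δ, μ} ⊆ S ∧ (∀ x ∈ S, |x| ≤ 2 * m) ∧
      (∀ k : ℕ, k ≤ 2 * m + 1 → ∑ x ∈ S, w x * x ^ k = 0) ∧ w δ = 1 ∧ w μ ≤ 0 ∧
      w 0 ≤ -((1 - δ / μ) * (1 - 2 * δ ^ 2)) ∧
      ∑ x ∈ S \ {0, δ, μ}, |w x| ≤ 16 * δ * μ := by
  have hm1 : (1 : ℝ) ≤ m := by exact_mod_cast hm
  obtain ⟨hQδ, hQδ1, hQδ2⟩ := sineProd_bounds m hδ.le (by linarith : δ ≤ 1 / 2)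
  obtain ⟨hQμ, -, -⟩ := sineProd_bounds m (by linarith : 0 ≤ μ) hμ
  have hnot : ∀ t : ℝ, 0 < t → t ≤ 1 / 2 → t ∉ symmNodes m := fun t h0 h1 h => by
    have := one_le_abs_of_mem_symmNodes h h0.ne'
    rw [abs_of_pos h0] at this
    linarith
  have hδZ := hnot δ hδ (by linarith)
  have hμZ := hnot μ (by linarith) hμ
  have hδS : δ ∉ insert μ (symmNodes m) := by simp [hδZ, hδμ.ne]
  set S := insert δ (insert μ (symmNodes m)) with hS
  set A : ℝ := (-1) ^ m * (m.factorial : ℝ) ^ 2 with hA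
  have hA0 : A ≠ 0 := by
    rw [hA]
    exact mul_ne_zero (pow_ne_zero _ (by norm_num)) (pow_ne_zero _ (by positivity))
  have hμ0 : μ ≠ 0 := by linarith
  have hμδ0 : μ - δ ≠ 0 := by linarith
  have hδμ0 : δ - μ ≠ 0 := by linarith
  have hPδ : ∏ y ∈ S.erase δ, (δ - y) = (δ - μ) * (δ * (A * sineProd m δ)) := by
    rw [hS, Finset.erase_insert hδS, Finset.prod_insert hμZ, prod_symmNodes]
  have hPμ : ∏ y ∈ S.erase μ, (μ - y) = (μ - δ) * (μ * (A * sineProd m μ)) := by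
    rw [hS, Finset.insert_comm, Finset.erase_insert (by simp [hμZ, hδμ.ne']),
      Finset.prod_insert hδZ, prod_symmNodes]
  have hPx : ∀ x ∈ symmNodes m, ∏ y ∈ S.erase x, (x - y) =
      (x - δ) * ((x - μ) * ∏ y ∈ (symmNodes m).erase x, (x - y)) := by
    intro x hx
    have h1 : x ≠ δ := fun h => hδZ (h ▸ hx)
    have h2 : x ≠ μ := fun h => hμZ (h ▸ hx)
    rw [hS, Finset.erase_insert_of_ne h1.symm, Finset.erase_insert_of_ne h2.symm,
      Finset.prod_insert (by simp [hδZ, hδμ.ne]), Finset.prod_insert (by simp [hμZ])]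
  have hP0 : ∏ y ∈ (symmNodes m).erase 0, (0 - y) = A := by
    have := prod_symmNodes_erase m m m (by ring)
    rw [sub_self] at this
    rw [this, hA]
    ring
  set D : ℝ := (δ - μ) * (δ * (A * sineProd m δ)) with hD
  have hD0 : D ≠ 0 := mul_ne_zero hδμ0 (mul_ne_zero hδ.ne' (mul_ne_zero hA0 hQδ.ne'))
  refine ⟨S, fun x => D / ∏ y ∈ S.erase x, (x - y), ?_, ?_, ?_, ?_, ?_, ?_, ?_⟩
  · intro x hx
    simp only [Finset.mem_insert, Finset.mem_singleton] at hx
    rcases hx with rfl | rfl | rfl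
    · simp [hS, zero_mem_symmNodes]
    · simp [hS]
    · simp [hS]
  · intro x hx
    rw [hS, Finset.mem_insert, Finset.mem_insert] at hx
    rcases hx with rfl | rfl | hx
    · rw [abs_of_pos hδ]; linarith
    · rw [abs_of_pos (by linarith)]; linarith
    · linarith [abs_le_of_mem_symmNodes hx]
  · intro k hk
    have hcard : S.card = 2 * m + 3 := by
      rw [hS, Finset.card_insert_of_notMem hδS, Finset.card_insert_of_notMem hμZ, symmNodes,
        Finset.card_image_of_injective _ (injective_cast_sub m), Finset.card_range]
    have := sum_pow_div_prod_eq_zero S k (by omega)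
    calc _ = D * ∑ x ∈ S, x ^ k / ∏ y ∈ S.erase x, (x - y) := by
          rw [Finset.mul_sum]
          exact Finset.sum_congr rfl fun x _ => by ring
      _ = 0 := by rw [this, mul_zero]
  · simp only [hPδ]
    exact div_self hD0
  · simp only [hPμ, hD]
    have : (δ - μ) * (δ * (A * sineProd m δ)) / ((μ - δ) * (μ * (A * sineProd m μ))) =
        -(δ * sineProd m δ / (μ * sineProd m μ)) := by
      field_simp
      ring
    rw [this, neg_nonpos]
    have : 0 < μ := by linarith
    positivity
  · simp only [hPx 0 (zero_mem_symmNodes m), hP0, hD]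
    have : (δ - μ) * (δ * (A * sineProd m δ)) / ((0 - δ) * ((0 - μ) * A)) =
        -((1 - δ / μ) * sineProd m δ) := by
      rw [div_eq_iff (by simp [hδ.ne', hμ0, hA0])]
      field_simp
      ring
    rw [this, neg_le_neg_iff]
    have : δ / μ ≤ 1 := div_le_one_of_le₀ hδμ.le (by linarith)
    exact mul_le_mul_of_nonneg_left hQδ2 (by linarith)
  · have hsub : S \ {0, δ, μ} ⊆ symmNodes m := by
      intro x hx
      simp only [hS, Finset.mem_sdiff, Finset.mem_insert, Finset.mem_singleton] at hx
      tauto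
    have hterm : ∀ x ∈ S \ {0, δ, μ},
        |D / ∏ y ∈ S.erase x, (x - y)| ≤ 4 * δ * μ * (x ^ 2)⁻¹ := by
      intro x hx
      have hxZ := hsub hx
      have hx0 : x ≠ 0 := by
        rintro rfl
        simp at hx
      have hx1 := one_le_abs_of_mem_symmNodes hxZ hx0
      rw [hPx x hxZ, hD]
      have e : (δ - μ) * (δ * (A * sineProd m δ)) /
          ((x - δ) * ((x - μ) * ∏ y ∈ (symmNodes m).erase x, (x - y))) =
          ((δ - μ) * δ * sineProd m δ) * (A / ∏ y ∈ (symmNodes m).erase x, (x - y)) *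
            ((x - δ)⁻¹ * (x - μ)⁻¹) := by
        simp only [div_eq_mul_inv, mul_inv]
        ring
      rw [e, abs_mul, abs_mul]
      have h1 : |(δ - μ) * δ * sineProd m δ| ≤ δ * μ := by
        rw [abs_mul, abs_mul, abs_of_pos hδ, abs_of_pos hQδ, abs_of_neg (by linarith)]
        have hμn : 0 ≤ μ := by linarith
        calc -(δ - μ) * δ * sineProd m δ ≤ μ * δ * 1 := by
              gcongr
              linarith
          _ = δ * μ := by ring
      have h2 := abs_div_prod_symmNodes_erase_le m hxZ
      have h3 : |(x - δ)⁻¹ * (x - μ)⁻¹| ≤ 4 * (x ^ 2)⁻¹ :=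
        abs_inv_sub_mul_inv_sub_le hx1 hδ.le (by linarith) (by linarith) hμ
      have hδμn : 0 ≤ δ * μ := mul_nonneg hδ.le (by linarith)
      calc _ ≤ (δ * μ) * 1 * (4 * (x ^ 2)⁻¹) := by gcongr
        _ = _ := by ring
    have hδμn : 0 ≤ 4 * δ * μ := mul_nonneg (by linarith) (by linarith)
    calc _ ≤ ∑ x ∈ S \ {0, δ, μ}, 4 * δ * μ * (x ^ 2)⁻¹ := Finset.sum_le_sum hterm
      _ ≤ ∑ x ∈ symmNodes m, 4 * δ * μ * (x ^ 2)⁻¹ :=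
          Finset.sum_le_sum_of_subset_of_nonneg hsub fun x _ _ => by positivity
      _ = 4 * δ * μ * ∑ x ∈ symmNodes m, (x ^ 2)⁻¹ := by rw [Finset.mul_sum]
      _ ≤ 4 * δ * μ * 4 := by gcongr; exact sum_inv_sq_symmNodes m
      _ = _ := by ring

/-- Moment bound for a probability vector concentrated on points of size at most `r`. -/
lemma abs_sum_mul_pow_le {S N : Finset ℝ} {p : ℝ → ℝ} {r R ε τ : ℝ} (hN : N ⊆ S)
    (hp : ∀ x ∈ S, 0 ≤ p x) (hsum : ∑ x ∈ S, p x = 1) (hτ : 0 < τ) (hr0 : 0 ≤ r) (hr1 : r ≤ 1)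
    (hrε : r ^ 2 ≤ ε) (hR : 1 ≤ R) (hNr : ∀ x ∈ N, |x| ≤ r) (hSR : ∀ x ∈ S, |x| ≤ R)
    (hfar : ∑ x ∈ S \ N, p x ≤ ε) {k : ℕ} (hk : 2 ≤ k) :
    |∑ x ∈ S, p x * (x / τ) ^ k| ≤ 2 * ε * (R / τ) ^ k := by
  have hε : 0 ≤ ε := (sq_nonneg r).trans hrε
  have hnear : ∑ x ∈ N, p x ≤ 1 :=
    hsum ▸ Finset.sum_le_sum_of_subset_of_nonneg hN fun x hx _ => hp x hx
  have hle : ∑ x ∈ S, p x * |x| ^ k ≤ 2 * ε * R ^ k := by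
    rw [← Finset.sum_sdiff hN]
    have h1 : ∑ x ∈ S \ N, p x * |x| ^ k ≤ ε * R ^ k := by
      calc _ ≤ ∑ x ∈ S \ N, p x * R ^ k := Finset.sum_le_sum fun x hx => by
            have hx' := (Finset.mem_sdiff.1 hx).1
            have := hp x hx'
            have := hSR x hx'
            gcongr
        _ = (∑ x ∈ S \ N, p x) * R ^ k := by rw [Finset.sum_mul]
        _ ≤ ε * R ^ k := by gcongr
    have h2 : ∑ x ∈ N, p x * |x| ^ k ≤ ε * R ^ k := by
      calc _ ≤ ∑ x ∈ N, p x * r ^ k := Finset.sum_le_sum fun x hx => by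
            have := hp x (hN hx)
            have := hNr x hx
            gcongr
        _ = (∑ x ∈ N, p x) * r ^ k := by rw [Finset.sum_mul]
        _ ≤ 1 * r ^ 2 := by
            gcongr ?_ * ?_
            exact pow_le_pow_of_le_one hr0 hr1 hk
        _ ≤ ε * 1 := by linarith
        _ ≤ ε * R ^ k := by gcongr; exact one_le_pow₀ hR
    linarith
  calc |∑ x ∈ S, p x * (x / τ) ^ k| ≤ ∑ x ∈ S, |p x * (x / τ) ^ k| :=
        Finset.abs_sum_le_sum_abs _ _
    _ = ∑ x ∈ S, p x * |x| ^ k / τ ^ k := Finset.sum_congr rfl fun x hx => by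
        rw [abs_mul, abs_pow, abs_div, abs_of_pos hτ, abs_of_nonneg (hp x hx), div_pow,
          mul_div_assoc]
    _ = (∑ x ∈ S, p x * |x| ^ k) / τ ^ k := by rw [Finset.sum_div]
    _ ≤ 2 * ε * R ^ k / τ ^ k := by gcongr
    _ = _ := by rw [div_pow, mul_div_assoc]

/-- Moment-matching priors (Proposition 5.4): for any `εmax ∈ (0,1/2)` there is a constant
`c > 0` such that for all `ε ∈ (0,εmax]`, `K` a positive multiple of 4 and `τ > 0`, there
exist finitely supported probability measures `ν₀, ν₁` with the stated point concentration,
moment matching up to order `K+1`, and moment magnitude bounds. -/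
theorem moment_matching_priors (εmax : ℝ) (hεm : εmax ∈ Set.Ioo (0:ℝ) (1/2)) :
    ∃ c : ℝ, 0 < c ∧
      ∀ ε : ℝ, ε ∈ Set.Ioc (0:ℝ) εmax → ∀ K : ℕ, 0 < K → 4 ∣ K → ∀ τ : ℝ, 0 < τ →
        ∃ ν₀ ν₁ : Measure ℝ, IsProbabilityMeasure ν₀ ∧ IsProbabilityMeasure ν₁ ∧
          (∃ s : Finset ℝ, ν₀ (s : Set ℝ) = 1) ∧
          (∃ s : Finset ℝ, ν₁ (s : Set ℝ) = 1) ∧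
          ENNReal.ofReal (1 - εmax) ≤ ν₀ {0} ∧
          ENNReal.ofReal (1 - ε) ≤ ν₁ {c * ε ^ ((1:ℝ)/2) / τ} ∧
          (∀ k : ℕ, k ≤ K + 1 → (∫ y, y ^ k ∂ν₀) = ∫ y, y ^ k ∂ν₁) ∧
          ((1 : ℝ) ≤ (K : ℝ) / τ → ∀ k : ℕ, 2 ≤ k →
            |∫ y, y ^ k ∂ν₀| ≤ 2 * ε * ((K : ℝ) / τ) ^ k ∧
            |∫ y, y ^ k ∂ν₁| ≤ 2 * ε * ((K : ℝ) / τ) ^ k) := by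
  obtain ⟨hb0, hb1⟩ := hεm
  refine ⟨εmax / 128, by positivity, ?_⟩
  rintro ε ⟨hε0, hε1⟩ K hK ⟨l, hl⟩ τ hτ
  rw [← Real.sqrt_eq_rpow]
  have hs0 : 0 < √ε := Real.sqrt_pos.2 hε0
  have hs2 : √ε * √ε = ε := Real.mul_self_sqrt hε0.le
  have hs1 : √ε ≤ 1 := by nlinarith
  set δ := εmax / 128 * √ε with hδ
  set μ := √ε / 32 with hμ
  have hδ0 : 0 < δ := by positivity
  have hδμ : δ < μ := by rw [hδ, hμ]; nlinarith
  have hratio : δ / μ = εmax / 4 := by rw [hδ, hμ]; field_simp; norm_num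
  obtain ⟨S, w, hN, hSK, hmom, hwδ, hwμ, hw0, hfar⟩ :=
    exists_annihilating_weights (2 * l) (by omega) hδ0 hδμ (by rw [hμ]; linarith)
  have hKl : ((2 : ℝ) * ((2 * l : ℕ) : ℝ)) = K := by rw [hl]; push_cast; ring
  rw [hKl] at hSK
  have hfar' : ∑ x ∈ S \ {0, δ, μ}, |w x| ≤ ε / 2 := by
    refine hfar.trans ?_
    have : 16 * δ * μ = εmax / 256 * (√ε * √ε) := by rw [hδ, hμ]; ring
    rw [this, hs2]
    nlinarith
  have hδ2 : δ ^ 2 ≤ εmax / 16 := by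
    have : δ ^ 2 = εmax ^ 2 / 16384 * (√ε * √ε) := by rw [hδ]; ring
    rw [this, hs2]
    have : ε ≤ 1 := by linarith
    nlinarith [mul_nonneg hb0.le hε0.le, sq_nonneg εmax]
  have hw0' : w 0 ≤ -(1 - εmax / 2) := by
    refine hw0.trans ?_
    rw [hratio]
    nlinarith [sq_nonneg δ, mul_nonneg hb0.le (sq_nonneg δ)]
  have hfarle : ∀ f : ℝ → ℝ, (∀ x, f x ≤ |w x|) → ∑ x ∈ S \ {0, δ, μ}, f x ≤ ε / 2 :=
    fun f hf => (Finset.sum_le_sum fun x _ => hf x).trans hfar'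
  have hpos : ∀ x, (w x)⁺ ≤ |w x| := fun x => by
    linarith [posPart_add_negPart (w x), negPart_nonneg (w x)]
  have hneg : ∀ x, (w x)⁻ ≤ |w x| := fun x => by
    linarith [posPart_add_negPart (w x), posPart_nonneg (w x)]
  have hnear : ∑ x ∈ ({0, δ, μ} : Finset ℝ), (w x)⁺ = 1 := by
    rw [Finset.sum_insert (by simp [hδ0.ne, (hδ0.trans hδμ).ne]),
      Finset.sum_insert (by simp [hδμ.ne]), Finset.sum_singleton,
      posPart_eq_zero.2 (by linarith : w 0 ≤ 0), posPart_eq_zero.2 hwμ, hwδ]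
    simp
  set T := ∑ x ∈ S, (w x)⁺ with hT
  have hTsplit : T = ∑ x ∈ S \ {0, δ, μ}, (w x)⁺ + 1 := by
    rw [hT, ← Finset.sum_sdiff hN, hnear]
  have hT1 : 1 ≤ T := by
    rw [hTsplit, le_add_iff_nonneg_left]
    exact Finset.sum_nonneg fun x _ => posPart_nonneg _
  have hT2 : T ≤ 1 + ε / 2 := by
    have := hfarle (fun x => (w x)⁺) hpos
    linarith
  have hmom' : ∀ k ≤ K + 1, ∑ x ∈ S, (w x)⁻ * x ^ k = ∑ x ∈ S, (w x)⁺ * x ^ k := by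
    intro k hk
    have := hmom k (by omega)
    rw [eq_comm, ← sub_eq_zero, ← Finset.sum_sub_distrib, ← this]
    refine Finset.sum_congr rfl fun x _ => ?_
    rw [← sub_mul, posPart_sub_negPart]
  have hT' : ∑ x ∈ S, (w x)⁻ = T := by simpa using hmom' 0 (by omega)
  have hT0 : 0 < T := by linarith
  have hsum₁ : ∑ x ∈ S, (w x)⁺ / T = 1 := by rw [← Finset.sum_div, ← hT, div_self hT0.ne']
  have hsum₀ : ∑ x ∈ S, (w x)⁻ / T = 1 := by rw [← Finset.sum_div, hT', div_self hT0.ne']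
  have hp₁ : ∀ x ∈ S, 0 ≤ (w x)⁺ / T := fun x _ => div_nonneg (posPart_nonneg _) hT0.le
  have hp₀ : ∀ x ∈ S, 0 ≤ (w x)⁻ / T := fun x _ => div_nonneg (negPart_nonneg _) hT0.le
  obtain ⟨ν₀, hprob₀, hfin₀, hmass₀, hint₀⟩ :=
    exists_discrete_measure S (fun x => (w x)⁻ / T) hp₀ hsum₀ τ
  obtain ⟨ν₁, hprob₁, hfin₁, hmass₁, hint₁⟩ :=
    exists_discrete_measure S (fun x => (w x)⁺ / T) hp₁ hsum₁ τ
  refine ⟨ν₀, ν₁, hprob₀, hprob₁, hfin₀, hfin₁, ?_, ?_, ?_, ?_⟩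
  · have h := hmass₀ 0 (hN (by simp))
    rw [zero_div] at h
    refine le_trans (ENNReal.ofReal_le_ofReal ?_) h
    rw [le_div_iff₀ hT0]
    have := neg_le_negPart (w 0)
    nlinarith
  · refine le_trans (ENNReal.ofReal_le_ofReal ?_) (hmass₁ δ (hN (by simp)))
    rw [le_div_iff₀ hT0, hwδ, posPart_of_nonneg zero_le_one]
    nlinarith
  · intro k hk
    rw [hint₀, hint₁]
    have key : ∀ f : ℝ → ℝ, ∑ x ∈ S, f x / T * (x / τ) ^ k =
        (∑ x ∈ S, f x * x ^ k) / (T * τ ^ k) := fun f => by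
      rw [Finset.sum_div]
      exact Finset.sum_congr rfl fun x _ => by rw [div_pow, div_mul_div_comm]
    rw [key, key, hmom' k hk]
  · intro _ k hk
    rw [hint₀, hint₁]
    have hμ2 : μ ^ 2 ≤ ε := by
      have : μ ^ 2 = √ε * √ε / 1024 := by rw [hμ]; ring
      rw [this, hs2]
      linarith
    have hK1 : (1 : ℝ) ≤ K := by exact_mod_cast hK
    have hNμ : ∀ x ∈ ({0, δ, μ} : Finset ℝ), |x| ≤ μ := by
      intro x hx
      simp only [Finset.mem_insert, Finset.mem_singleton] at hx
      rcases hx with rfl | rfl | rfl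
      · rw [abs_zero]; linarith
      · rw [abs_of_pos hδ0]; exact hδμ.le
      · rw [abs_of_pos (by linarith)]
    have hμ0 : 0 ≤ μ := by linarith
    have hμ1 : μ ≤ 1 := by rw [hμ]; linarith
    refine ⟨abs_sum_mul_pow_le hN hp₀ hsum₀ hτ hμ0 hμ1 hμ2 hK1 hNμ hSK ?_ hk,
      abs_sum_mul_pow_le hN hp₁ hsum₁ hτ hμ0 hμ1 hμ2 hK1 hNμ hSK ?_ hk⟩
    · refine (hfarle _ fun x => ?_).trans (by linarith)
      exact (div_le_self (negPart_nonneg _) hT1).trans (hneg x)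
    · refine (hfarle _ fun x => ?_).trans (by linarith)
      exact (div_le_self (posPart_nonneg _) hT1).trans (hpos x)
end
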